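/- arXiv:1007.5265 — 2 statements merged into one kernel-verified Lean document; each statement's English description precedes it below -/
import Mathlib

section
/- Let (R, M) be a local integral domain with nonzero maximal ideal M which is finitely stable. Then R is stable if and only if: for each nonzero prime ideal P of R with P ≠ M, the localization R_P is a strongly discrete valuation domain, and M is a stable ideal of R. -/
open scoped Pointwise

section Defs

variable (A K : Type*) [CommRing A] [Field K] [Algebra A K]

/-- `I` is a nonzero fractional ideal of `A` (inside `K`):
`I ≠ 0` and `dI ⊆ A` for some nonzero `d ∈ A`. -/
def IsFrac (I : Submodule A K) : Prop :=
  I ≠ ⊥ ∧ ∃ d : A, d ≠ 0 ∧ ∀ x ∈ I, ∃ a : A, algebraMap A K d * x = algebraMap A K a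

/-- The divisorial closure `I^v = (A : (A : I))`; here `(J : I) = J / I` and
`(1 : Submodule A K)` is the image of `A` in `K`. -/
def vS (I : Submodule A K) : Submodule A K := 1 / (1 / I)

/-- The `t`-operation `I^t = ⋃ {J^v : J ⊆ I nonzero finitely generated}` (a directed union,
hence equal to the supremum of submodules). -/
def tS (I : Submodule A K) : Submodule A K :=
  ⨆ J ∈ {J : Submodule A K | J ≠ ⊥ ∧ J.FG ∧ J ≤ I}, vS A K J

/-- The image of an integral ideal of `A` in `K`. -/
def idealK (I : Ideal A) : Submodule A K := Submodule.map (Algebra.linearMap A K) I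

/-- A nonzero (fractional) ideal `I` is stable if `I((I:I):I) = (I:I)`. -/
def IsStableIdeal (I : Submodule A K) : Prop := I * ((I / I) / I) = I / I

/-- `A` is a stable domain: every nonzero (fractional) ideal is stable. -/
def StableDomain : Prop := ∀ I : Submodule A K, IsFrac A K I → IsStableIdeal A K I

/-- `A` is Clifford regular: every nonzero (fractional) ideal `I` satisfies `I = I²J`
for some nonzero `A`-submodule `J` of `K`. -/
def CliffordRegularDomain : Prop :=
  ∀ I : Submodule A K, IsFrac A K I → ∃ J : Submodule A K, J ≠ ⊥ ∧ I = I * I * J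

end Defs

/-- The localization `R_P ⊆ K` of `R` at the prime `P`: the subring of `K` generated by `R`
and the inverses of the elements of `R ∖ P`. -/
def locAlg (R K : Type*) [CommRing R] [Field K] [Algebra R K] (P : Ideal R) :
    Subalgebra R K :=
  Algebra.adjoin R {y : K | ∃ s : R, s ∉ P ∧ y = (algebraMap R K s)⁻¹}

/-- A valuation domain: any two elements are comparable under divisibility
(equivalently, the ideals are totally ordered by inclusion). -/
def IsValuationDomain (A : Type*) [CommRing A] : Prop := ∀ x y : A, x ∣ y ∨ y ∣ x

/-- A domain is strongly discrete if `P² ≠ P` for every nonzero prime ideal `P`. -/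
def StronglyDiscrete (A : Type*) [CommRing A] : Prop :=
  ∀ P : Ideal A, P.IsPrime → P ≠ ⊥ → P * P ≠ P

section FinitelyStable

variable {R K : Type*} [CommRing R] [Field K] [Algebra R K]

local notation "φ" => algebraMap R K

theorem IsStableIdeal.one_mem {I : Submodule R K} (h : IsStableIdeal R K I) :
    (1 : K) ∈ I * ((I / I) / I) := by
  rw [h, Submodule.mem_div_iff_forall_mul_mem]
  intro y hy
  simpa using hy

theorem isStableIdeal_of_mul_mem {I : Submodule R K} {b : K} (hb : b ∈ I) (hb0 : b ≠ 0)
    (h : ∀ x ∈ I, ∀ y ∈ I, x * y * b⁻¹ ∈ I) : IsStableIdeal R K I := by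
  refine le_antisymm (Submodule.mul_le.2 fun x hx y hy => ?_) fun e he => ?_
  · rw [mul_comm]
    exact hy x hx
  · have key : e * b⁻¹ ∈ (I / I) / I := by
      intro y hy z hz
      have := he _ (h y hy z hz)
      convert this using 1
      ring
    have := Submodule.mul_mem_mul hb key
    convert this using 1
    field_simp

/-- The elements of `(J : J)` are integral when `J` is finitely generated. -/
theorem isIntegral_of_mem_div_self {J : Submodule R K} (hJ : J ≠ ⊥) (hfg : J.FG) {x : K}
    (hx : x ∈ J / J) : IsIntegral R x :=
  isIntegral_of_smul_mem_submodule J hJ hfg x fun n hn => hx n hn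

/-- If the module `J` generated by `f` and `g` is stable, then `1 = f x + g y` with `x` and `y` in
`((J : J) : J)`. -/
theorem IsStableIdeal.exists_of_span_pair {f g : K}
    (h : IsStableIdeal R K (Submodule.span R {f, g})) :
    ∃ x y : K, f * x + g * y = 1 ∧
      (∀ j ∈ Submodule.span R {f, g},
        x * j ∈ Submodule.span R {f, g} / Submodule.span R {f, g}) ∧
      (∀ j ∈ Submodule.span R {f, g},
        y * j ∈ Submodule.span R {f, g} / Submodule.span R {f, g}) := by
  have h1 := h.one_mem
  set J := Submodule.span R {f, g} with hJ
  set X := (J / J) / J with hX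
  have key : ∀ z ∈ J * X, ∃ x ∈ X, ∃ y ∈ X, f * x + g * y = z := by
    intro z hz
    refine Submodule.mul_induction_on hz ?_ ?_
    · intro m hm n hn
      obtain ⟨a, b, rfl⟩ := Submodule.mem_span_pair.1 hm
      refine ⟨a • n, X.smul_mem _ hn, b • n, X.smul_mem _ hn, ?_⟩
      simp only [Algebra.smul_def]
      ring
    · rintro _ _ ⟨x, hx, y, hy, rfl⟩ ⟨x', hx', y', hy', rfl⟩
      exact ⟨x + x', X.add_mem hx hx', y + y', X.add_mem hy hy', by ring⟩
  obtain ⟨x, hx, y, hy, hxy⟩ := key 1 h1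
  exact ⟨x, y, hxy, fun j hj => hx j hj, fun j hj => hy j hj⟩

theorem span_pair_ne_bot {f g : K} (hf : f ≠ 0) : Submodule.span R {f, g} ≠ ⊥ := by
  intro h
  have : f ∈ Submodule.span R {f, g} := Submodule.subset_span (by simp)
  rw [h, Submodule.mem_bot] at this
  exact hf this

theorem exists_isIntegral_add_mul_eq_one
    (hfs : ∀ I : Submodule R K, I ≠ ⊥ → I.FG → IsStableIdeal R K I) (z : K) :
    ∃ x y : K, x + z * y = 1 ∧ IsIntegral R x ∧ IsIntegral R (z * x) ∧
      IsIntegral R y ∧ IsIntegral R (z * y) := by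
  have h0 : Submodule.span R {(1 : K), z} ≠ ⊥ := span_pair_ne_bot one_ne_zero
  have hfg : (Submodule.span R {(1 : K), z}).FG := Submodule.fg_span (by simp)
  obtain ⟨x, y, h1, hx, hy⟩ := (hfs _ h0 hfg).exists_of_span_pair
  have m1 : (1 : K) ∈ Submodule.span R {(1 : K), z} := Submodule.subset_span (by simp)
  have mz : z ∈ Submodule.span R {(1 : K), z} := Submodule.subset_span (by simp)
  refine ⟨x, y, by simpa using h1, ?_, ?_, ?_, ?_⟩
  · simpa using isIntegral_of_mem_div_self h0 hfg (hx _ m1)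
  · simpa [mul_comm] using isIntegral_of_mem_div_self h0 hfg (hx _ mz)
  · simpa using isIntegral_of_mem_div_self h0 hfg (hy _ m1)
  · simpa [mul_comm] using isIntegral_of_mem_div_self h0 hfg (hy _ mz)

/-- Over a finitely stable domain, a finitely generated module of integral elements containing `1`
is closed under multiplication. -/
theorem mul_self_le_of_isIntegral
    (hfs : ∀ I : Submodule R K, I ≠ ⊥ → I.FG → IsStableIdeal R K I) {s : Set K} (hs : s.Finite)
    (h1 : 1 ∈ s) (hint : ∀ x ∈ s, IsIntegral R x) :
    Submodule.span R s * Submodule.span R s ≤ Submodule.span R s := by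
  set J := Submodule.span R s with hJ
  have h1J : (1 : K) ∈ J := Submodule.subset_span h1
  have hJ0 : J ≠ ⊥ := fun h => by
    rw [h, Submodule.mem_bot] at h1J
    exact one_ne_zero h1J
  have hst := hfs J hJ0 (Submodule.fg_span hs)
  set X := (J / J) / J with hX
  have hXJJ : X * J * J = J := by
    rw [mul_comm X J, hst]
    refine le_antisymm (Submodule.mul_le.2 fun x hx y hy => hx y hy) fun x hx => ?_
    have : (1 : K) ∈ J / J := fun y hy => by simpa using hy
    simpa using Submodule.mul_mem_mul this hx
  have h1le : (1 : Submodule R K) ≤ J := Submodule.one_le.2 h1J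
  have hmono : Monotone fun n : ℕ => J ^ n := by
    refine monotone_nat_of_le_succ fun n => ?_
    calc J ^ n = J ^ n * 1 := (mul_one _).symm
      _ ≤ J ^ n * J := mul_le_mul_right h1le _
      _ = J ^ (n + 1) := (pow_succ _ _).symm
  set D := (Algebra.adjoin R s).toSubmodule with hD
  have hDfg : D.FG := fg_adjoin_of_finite hs hint
  have hDmem : ∀ x ∈ Algebra.adjoin R s, ∃ n : ℕ, x ∈ J ^ n := by
    intro x hx
    induction hx using Algebra.adjoin_induction with
    | mem x hx => exact ⟨1, by simpa using Submodule.subset_span hx⟩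
    | algebraMap r => exact ⟨0, by simp [Submodule.mem_one]⟩
    | add x y _ _ hx hy =>
      obtain ⟨n, hn⟩ := hx
      obtain ⟨k, hk⟩ := hy
      exact ⟨max n k, Submodule.add_mem _ (hmono (le_max_left n k) hn)
        (hmono (le_max_right n k) hk)⟩
    | mul x y _ _ hx hy =>
      obtain ⟨n, hn⟩ := hx
      obtain ⟨k, hk⟩ := hy
      exact ⟨n + k, by rw [pow_add]; exact Submodule.mul_mem_mul hn hk⟩
  have hJD : ∀ n : ℕ, J ^ n ≤ D := by
    have hJD1 : J ≤ D := Submodule.span_le.2 Algebra.subset_adjoin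
    intro n
    induction n with
    | zero => rw [pow_zero]; exact Submodule.one_le.2 (Algebra.adjoin R s).one_mem
    | succ n ih =>
      rw [pow_succ]
      exact Submodule.mul_le.2 fun x hx y hy => (Algebra.adjoin R s).mul_mem (ih hx) (hJD1 hy)
  obtain ⟨t, ht⟩ := hDfg
  have hn : ∃ n : ℕ, D ≤ J ^ n := by
    have hch : ∀ x ∈ t, ∃ n : ℕ, x ∈ J ^ n := fun x hx =>
      hDmem x (by
        have : x ∈ D := ht ▸ Submodule.subset_span hx
        exact this)
    choose! n hn using hch
    refine ⟨t.sup n, ?_⟩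
    rw [← ht, Submodule.span_le]
    intro x hx
    exact hmono (Finset.le_sup (f := n) hx) (hn x hx)
  obtain ⟨n, hn⟩ := hn
  have hdesc : ∀ n : ℕ, D ≤ J ^ (n + 1) → D ≤ J := by
    intro n
    induction n with
    | zero => intro h; simpa using h
    | succ n ih =>
      intro h
      apply ih
      have h2 : J ^ (n + 2) * J ≤ J ^ (n + 1) * J := by
        rw [← pow_succ, ← pow_succ]
        exact (hJD _).trans h
      have e1 : X * (J ^ (n + 2) * J) = J ^ (n + 2) := by
        calc X * (J ^ (n + 2) * J) = X * J * J * J ^ (n + 1) := by ring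
          _ = J ^ (n + 2) := by rw [hXJJ]; ring
      have e2 : X * (J ^ (n + 1) * J) = J ^ (n + 1) := by
        calc X * (J ^ (n + 1) * J) = X * J * J * J ^ n := by ring
          _ = J ^ (n + 1) := by rw [hXJJ]; ring
      have h3 := mul_le_mul_right h2 X
      rw [e1, e2] at h3
      exact h.trans h3
  have hDJ : D ≤ J := hdesc n (hn.trans (hmono (Nat.le_succ n)))
  exact (by simpa [pow_two] using hJD 2 : J * J ≤ D).trans hDJ

theorem exists_mul_eq_of_isIntegral
    (hfs : ∀ I : Submodule R K, I ≠ ⊥ → I.FG → IsStableIdeal R K I) {e f : K}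
    (he : IsIntegral R e) (hf : IsIntegral R f) :
    ∃ p q r : R, e * f = φ p + φ q * e + φ r * f := by
  have h := mul_self_le_of_isIntegral hfs (s := {1, e, f}) (by simp) (by simp) (by
    rintro x (rfl | rfl | rfl)
    exacts [isIntegral_one, he, hf])
  have hef := h (Submodule.mul_mem_mul (Submodule.subset_span (by simp : e ∈ _))
    (Submodule.subset_span (by simp : f ∈ _)))
  obtain ⟨p, q, r, h⟩ := Submodule.mem_span_triple.1 hef
  refine ⟨p, q, r, ?_⟩
  rw [← h]
  simp [Algebra.smul_def]

theorem exists_sq_eq_of_isIntegral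
    (hfs : ∀ I : Submodule R K, I ≠ ⊥ → I.FG → IsStableIdeal R K I) {e : K}
    (he : IsIntegral R e) : ∃ a b : R, e * e = φ a * e + φ b := by
  obtain ⟨p, q, r, h⟩ := exists_mul_eq_of_isIntegral hfs he he
  exact ⟨q + r, p, by rw [h, map_add]; ring⟩

end FinitelyStable

section Localization

variable {R K : Type*} [CommRing R] [Field K] [Algebra R K] [IsFractionRing R K]

local notation "φ" => algebraMap R K

theorem algebraMap_ne_zero_of_notMem {P : Ideal R} {s : R} (hs : s ∉ P) : φ s ≠ 0 := by
  rw [Ne, IsFractionRing.to_map_eq_zero_iff]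
  rintro rfl
  exact hs P.zero_mem

theorem mem_locAlg_iff {P : Ideal R} (hP : P.IsPrime) {x : K} :
    x ∈ locAlg R K P ↔ ∃ r s : R, s ∉ P ∧ x = φ r / φ s := by
  constructor
  · intro hx
    induction hx using Algebra.adjoin_induction with
    | mem x hx =>
      obtain ⟨s, hs, rfl⟩ := hx
      exact ⟨1, s, hs, by simp⟩
    | algebraMap r => exact ⟨r, 1, fun h => hP.ne_top ((Ideal.eq_top_iff_one _).2 h), by simp⟩
    | add x y _ _ hx hy =>
      obtain ⟨r, s, hs, rfl⟩ := hx
      obtain ⟨r', s', hs', rfl⟩ := hy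
      refine ⟨r * s' + s * r', s * s', fun h => (hP.mem_or_mem h).elim hs hs', ?_⟩
      rw [div_add_div _ _ (algebraMap_ne_zero_of_notMem hs) (algebraMap_ne_zero_of_notMem hs')]
      simp
    | mul x y _ _ hx hy =>
      obtain ⟨r, s, hs, rfl⟩ := hx
      obtain ⟨r', s', hs', rfl⟩ := hy
      refine ⟨r * r', s * s', fun h => (hP.mem_or_mem h).elim hs hs', ?_⟩
      simp [div_mul_div_comm]
  · rintro ⟨r, s, hs, rfl⟩
    rw [div_eq_mul_inv]
    exact mul_mem (algebraMap_mem _ r) (Algebra.subset_adjoin ⟨s, hs, rfl⟩)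

/-- The maximal ideal `P R_P` of the localization of `R` at `P`, as a submodule of `K`. -/
def locMax (K : Type*) [Field K] [Algebra R K] [IsFractionRing R K] {P : Ideal R}
    (hP : P.IsPrime) : Submodule R K where
  carrier := {x | ∃ p ∈ P, ∃ s : R, s ∉ P ∧ x = algebraMap R K p / algebraMap R K s}
  zero_mem' := ⟨0, P.zero_mem, 1, fun h => hP.ne_top ((Ideal.eq_top_iff_one _).2 h), by simp⟩
  add_mem' := by
    rintro _ _ ⟨r, hr, s, hs, rfl⟩ ⟨r', hr', s', hs', rfl⟩
    refine ⟨r * s' + s * r', P.add_mem (P.mul_mem_right _ hr) (P.mul_mem_left _ hr'), s * s',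
      fun h => (hP.mem_or_mem h).elim hs hs', ?_⟩
    rw [div_add_div _ _ (algebraMap_ne_zero_of_notMem hs) (algebraMap_ne_zero_of_notMem hs')]
    simp
  smul_mem' := by
    rintro c _ ⟨r, hr, s, hs, rfl⟩
    exact ⟨c * r, P.mul_mem_left _ hr, s, hs, by simp [Algebra.smul_def, mul_div_assoc]⟩

variable {P : Ideal R} (hP : P.IsPrime)

include hP in
theorem one_notMem_of_isPrime : (1 : R) ∉ P := fun h => hP.ne_top ((Ideal.eq_top_iff_one _).2 h)

theorem mem_locAlg_of_mem_locMax {x : K} (hx : x ∈ locMax K hP) : x ∈ locAlg R K P := by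
  obtain ⟨p, _, s, hs, rfl⟩ := hx
  exact (mem_locAlg_iff hP).2 ⟨p, s, hs, rfl⟩

theorem mul_mem_locMax {x y : K} (hx : x ∈ locAlg R K P) (hy : y ∈ locMax K hP) :
    x * y ∈ locMax K hP := by
  obtain ⟨r, s, hs, rfl⟩ := (mem_locAlg_iff hP).1 hx
  obtain ⟨r', hr', s', hs', rfl⟩ := hy
  exact ⟨r * r', P.mul_mem_left _ hr', s * s', fun h => (hP.mem_or_mem h).elim hs hs',
    by simp [div_mul_div_comm]⟩

theorem algebraMap_mem_locMax {r : R} : φ r ∈ locMax K hP ↔ r ∈ P := by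
  constructor
  · rintro ⟨p, hp, s, hs, h⟩
    rw [eq_div_iff (algebraMap_ne_zero_of_notMem hs), ← map_mul] at h
    have := IsFractionRing.injective R K h
    exact (hP.mem_or_mem (this ▸ hp : r * s ∈ P)).resolve_right hs
  · intro h
    exact ⟨r, h, 1, one_notMem_of_isPrime hP, by simp⟩

theorem one_notMem_locMax : (1 : K) ∉ locMax K hP := by
  rw [← map_one φ, algebraMap_mem_locMax]
  exact one_notMem_of_isPrime hP

theorem inv_mem_locAlg {x : K} (hx : x ∈ locAlg R K P) (hx' : x ∉ locMax K hP) :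
    x⁻¹ ∈ locAlg R K P := by
  obtain ⟨r, s, hs, rfl⟩ := (mem_locAlg_iff hP).1 hx
  exact (mem_locAlg_iff hP).2 ⟨s, r, fun h => hx' ⟨r, h, s, hs, rfl⟩, by simp⟩

theorem one_sub_inv_mem_locAlg {x : K} (hx : x ∈ locMax K hP) :
    1 - x ≠ 0 ∧ (1 - x)⁻¹ ∈ locAlg R K P := by
  have h : 1 - x ∉ locMax K hP := fun h => one_notMem_locMax (K := K) hP (by
    simpa using (locMax K hP).add_mem h hx)
  exact ⟨fun h0 => h (h0 ▸ (locMax K hP).zero_mem),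
    inv_mem_locAlg hP (sub_mem (one_mem _) (mem_locAlg_of_mem_locMax hP hx)) h⟩

theorem exists_mul_sub_one_mem_locMax
    (hfs : ∀ I : Submodule R K, I ≠ ⊥ → I.FG → IsStableIdeal R K I) {p s : R} (hp : p ∈ P)
    (hp0 : p ≠ 0) (hs : s ∉ P) :
    ∃ y ∈ locAlg R K P, (∃ r : R, φ p * φ p * y = φ r) ∧ φ s * y - 1 ∈ locMax K hP := by
  have hp0' : φ p ≠ 0 := by rwa [Ne, IsFractionRing.to_map_eq_zero_iff]
  have hs0 : φ s ≠ 0 := algebraMap_ne_zero_of_notMem hs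
  obtain ⟨x, y, h1, hx, hy⟩ :=
    (hfs _ (span_pair_ne_bot (g := φ s) hp0') (Submodule.fg_span (by simp))).exists_of_span_pair
  have mp : φ p ∈ Submodule.span R {φ p, φ s} := Submodule.subset_span (by simp)
  have ms : φ s ∈ Submodule.span R {φ p, φ s} := Submodule.subset_span (by simp)
  obtain ⟨a, b, hab⟩ := Submodule.mem_span_pair.1 (hx _ ms _ ms)
  obtain ⟨c, d, hcd⟩ := Submodule.mem_span_pair.1 (hy _ mp _ mp)
  simp only [Algebra.smul_def] at hab hcd
  have hpx : φ p * x ∈ locMax K hP := by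
    refine ⟨p * (a * p + b * s), P.mul_mem_right _ hp, s * s,
      fun h => (hP.mem_or_mem h).elim hs hs, ?_⟩
    rw [eq_div_iff (by simpa using hs0)]
    simp only [map_mul, map_add, hab]
    ring
  refine ⟨y, ?_, ⟨c * p + d * s, ?_⟩, ?_⟩
  · have : y = (1 - φ p * x) * (φ s)⁻¹ := by
      rw [eq_mul_inv_iff_mul_eq₀ hs0, ← h1]
      ring
    rw [this]
    exact mul_mem (sub_mem (one_mem _) (mem_locAlg_of_mem_locMax hP hpx))
      (Algebra.subset_adjoin ⟨s, hs, rfl⟩)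
  · simp only [map_mul, map_add, hcd]
    ring
  · have : φ s * y - 1 = -(φ p * x) := by rw [← h1]; ring
    rw [this]
    exact neg_mem hpx

variable [IsDomain R]

theorem StableDomain.mem_locAlg_of_mul_self [IsLocalRing R] (hst : StableDomain R K)
    (hfs : ∀ I : Submodule R K, I ≠ ⊥ → I.FG → IsStableIdeal R K I)
    (hP : P.IsPrime) (hP0 : P ≠ ⊥) (hPM : P ≠ IsLocalRing.maximalIdeal R) {b c d : K}
    (hc : c ∈ locAlg R K P) (hd : d ∈ locAlg R K P) (hb : b * b = c + d * b) :
    b ∈ locAlg R K P := by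
  by_contra hbV
  have hinj := IsFractionRing.injective R K
  obtain ⟨p, hp, hp0⟩ := Submodule.exists_mem_ne_zero_of_ne_bot hP0
  have hp0' : φ p ≠ 0 := by rwa [Ne, IsFractionRing.to_map_eq_zero_iff]
  obtain ⟨m, hm, hmP⟩ : ∃ m ∈ IsLocalRing.maximalIdeal R, m ∉ P := by
    by_contra! h
    exact hPM (le_antisymm (IsLocalRing.le_maximalIdeal hP.ne_top) h)
  let A : Submodule R K :=
    { carrier := {w | w ∈ locAlg R K P ∧ ∃ r : R, φ p * φ p * w = φ r}
      zero_mem' := ⟨zero_mem _, 0, by simp⟩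
      add_mem' := by
        rintro x y ⟨hx, r, hr⟩ ⟨hy, r', hr'⟩
        exact ⟨add_mem hx hy, r + r', by rw [mul_add, hr, hr', map_add]⟩
      smul_mem' := by
        rintro a x ⟨hx, r, hr⟩
        refine ⟨Subalgebra.smul_mem _ hx a, a * r, ?_⟩
        rw [map_mul, ← hr, Algebra.smul_def]
        ring }
  have hA : ∀ w, w ∈ A ↔ w ∈ locAlg R K P ∧ ∃ r : R, φ p * φ p * w = φ r := fun w => Iff.rfl
  set I := A ⊔ Submodule.span R {b} with hIdef
  have hI : ∀ x, x ∈ I ↔ ∃ a ∈ A, ∃ r : R, x = a + φ r * b := by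
    intro x
    rw [hIdef, Submodule.mem_sup]
    constructor
    · rintro ⟨a, ha, z, hz, rfl⟩
      obtain ⟨r, rfl⟩ := Submodule.mem_span_singleton.1 hz
      exact ⟨a, ha, r, by rw [Algebra.smul_def]⟩
    · rintro ⟨a, ha, r, rfl⟩
      exact ⟨a, ha, _, Submodule.mem_span_singleton.2 ⟨r, rfl⟩, by rw [Algebra.smul_def]⟩
  have hb0 : b ≠ 0 := by
    rintro rfl
    exact hbV (zero_mem _)
  have h1A : (1 : K) ∈ A := (hA _).2 ⟨one_mem _, p * p, by simp⟩
  have h1I : (1 : K) ∈ I := (hI _).2 ⟨1, h1A, 0, by simp⟩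
  have hbI : b ∈ I := (hI _).2 ⟨0, A.zero_mem, 1, by simp⟩
  have hfrac : IsFrac R K I := by
    refine ⟨fun h => ?_, ?_⟩
    · rw [h, Submodule.mem_bot] at h1I
      exact one_ne_zero h1I
    · obtain ⟨n, e, he, hne⟩ := IsFractionRing.div_surjective (A := R) b
      have he0 : e ≠ 0 := nonZeroDivisors.ne_zero he
      have he0' : φ e ≠ 0 := by rwa [Ne, IsFractionRing.to_map_eq_zero_iff]
      refine ⟨p * p * e, mul_ne_zero (mul_ne_zero hp0 hp0) he0, fun x hx => ?_⟩
      obtain ⟨a, ha, r, rfl⟩ := (hI _).1 hx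
      obtain ⟨-, r', hr'⟩ := (hA _).1 ha
      refine ⟨e * r' + p * p * r * n, ?_⟩
      have : φ n = φ e * b := by rw [← hne]; field_simp
      simp only [map_mul, map_add, ← hr', this]
      ring
  have hbw : ∀ w ∈ locAlg R K P, b * w ∈ locAlg R K P → w ∈ locMax K hP := by
    intro w hw hbw
    by_contra h
    refine hbV ?_
    have hw0 : w ≠ 0 := fun h0 => h (h0 ▸ (locMax K hP).zero_mem)
    have := mul_mem hbw (inv_mem_locAlg hP hw h)
    rwa [mul_assoc, mul_inv_cancel₀ hw0, mul_one] at this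
  have hmap : ∀ r : R, φ r ∈ locAlg R K P := fun r => algebraMap_mem _ r
  have hdiv : ∀ t ∈ I / I, ∃ v ∈ locAlg R K P, ∃ r ∈ P, t = v + φ r * b := by
    intro t ht
    obtain ⟨v, hv, r, hvr⟩ := (hI _).1 (ht _ h1I)
    rw [mul_one] at hvr
    have hvV := ((hA _).1 hv).1
    refine ⟨v, hvV, r, ?_, hvr⟩
    by_contra hrP
    have hs : r * m ∉ P := fun h => (hP.mem_or_mem h).elim hrP hmP
    obtain ⟨a, haV, har, has⟩ := exists_mul_sub_one_mem_locMax hP hfs hp hp0 hs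
    have haI : a ∈ I := (hI _).2 ⟨a, (hA _).2 ⟨haV, har⟩, 0, by simp⟩
    obtain ⟨v', hv', r', hvr'⟩ := (hI _).1 (ht _ haI)
    have hv'V := ((hA _).1 hv').1
    have h1 : φ r * a - φ r' ∈ locMax K hP := by
      refine hbw _ (sub_mem (mul_mem (hmap r) haV) (hmap r')) ?_
      have : b * (φ r * a - φ r') = v' - v * a := by
        rw [hvr] at hvr'
        linear_combination hvr'
      rw [this]
      exact sub_mem hv'V (mul_mem hvV haV)
    have h2 : φ (1 - m * r') ∈ locMax K hP := by
      have := sub_mem (mul_mem_locMax hP (hmap m) h1) has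
      convert this using 1
      simp only [map_sub, map_one, map_mul]
      ring
    rw [algebraMap_mem_locMax] at h2
    refine hP.ne_top (Ideal.eq_top_of_isUnit_mem _ h2 ?_)
    exact IsLocalRing.isUnit_one_sub_self_of_mem_nonunits _
      ((IsLocalRing.mem_maximalIdeal _).1 (Ideal.mul_mem_right _ _ hm))
  have hX : ∀ y ∈ (I / I) / I, ∃ v ∈ locMax K hP, ∃ r ∈ P, y = v + φ r * b := by
    intro y hy
    have h1 := hy _ h1I
    rw [mul_one] at h1
    obtain ⟨v, hv, r, hr, hvr⟩ := hdiv _ h1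
    obtain ⟨v2, hv2, r2, hr2, hvr2⟩ := hdiv _ (hy _ hbI)
    refine ⟨v, ?_, r, hr, hvr⟩
    have h3 : v + φ r * d - φ r2 ∈ locMax K hP := by
      refine hbw _ (sub_mem (add_mem hv (mul_mem (hmap _) hd)) (hmap _)) ?_
      have : b * (v + φ r * d - φ r2) = v2 - φ r * c := by
        rw [hvr] at hvr2
        linear_combination hvr2 - φ r * hb
      rw [this]
      exact sub_mem hv2 (mul_mem (hmap _) hc)
    have h4 : φ r * d ∈ locMax K hP := by
      rw [mul_comm]
      exact mul_mem_locMax hP hd ((algebraMap_mem_locMax hP).2 hr)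
    have h5 := (algebraMap_mem_locMax (K := K) hP).2 hr2
    have := add_mem (sub_mem h3 h4) h5
    convert this using 1
    ring
  have hprod : ∀ z ∈ I * ((I / I) / I), ∃ p1 ∈ locMax K hP, ∃ p2 ∈ locMax K hP,
      z = p1 + b * p2 := by
    intro z hz
    refine Submodule.mul_induction_on hz ?_ ?_
    · intro i hi y hy
      obtain ⟨a, ha, t, rfl⟩ := (hI _).1 hi
      obtain ⟨v, hv, r, hr, rfl⟩ := hX _ hy
      have haV := ((hA _).1 ha).1
      have hr' := (algebraMap_mem_locMax (K := K) hP).2 hr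
      refine ⟨a * v + (φ t * c) * φ r, add_mem (mul_mem_locMax hP haV hv)
        (mul_mem_locMax hP (mul_mem (hmap _) hc) hr'),
        a * φ r + φ t * v + (φ t * d) * φ r, add_mem (add_mem (mul_mem_locMax hP haV hr')
        (mul_mem_locMax hP (hmap _) hv)) (mul_mem_locMax hP (mul_mem (hmap _) hd) hr'), ?_⟩
      linear_combination φ t * φ r * hb
    · rintro _ _ ⟨x, hx, y, hy, rfl⟩ ⟨x', hx', y', hy', rfl⟩
      exact ⟨x + x', add_mem hx hx', y + y', add_mem hy hy', by ring⟩
  obtain ⟨p1, hp1, p2, hp2, h12⟩ := hprod 1 (hst I hfrac).one_mem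
  obtain ⟨hne, hinv⟩ := one_sub_inv_mem_locAlg hP hp1
  refine hbV ?_
  have hbinv : b * (p2 * (1 - p1)⁻¹) = 1 := by
    field_simp
    linear_combination -h12
  have : b = c * (p2 * (1 - p1)⁻¹) + d := by
    calc b = b * b * (p2 * (1 - p1)⁻¹) := by rw [mul_assoc, hbinv, mul_one]
      _ = c * (p2 * (1 - p1)⁻¹) + d * (b * (p2 * (1 - p1)⁻¹)) := by rw [hb]; ring
      _ = _ := by rw [hbinv, mul_one]
  rw [this]
  exact add_mem (mul_mem hc (mul_mem (mem_locAlg_of_mem_locMax hP hp2) hinv)) hd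

theorem StableDomain.isValuationDomain_locAlg [IsLocalRing R] (hst : StableDomain R K)
    (hfs : ∀ I : Submodule R K, I ≠ ⊥ → I.FG → IsStableIdeal R K I)
    (hP : P.IsPrime) (hP0 : P ≠ ⊥) (hPM : P ≠ IsLocalRing.maximalIdeal R) :
    IsValuationDomain (locAlg R K P) := by
  have hclaim : ∀ b c d : K, c ∈ locAlg R K P → d ∈ locAlg R K P → b * b = c + d * b →
      b ∈ locAlg R K P := fun b c d hc hd hb =>
    hst.mem_locAlg_of_mul_self hfs hP hP0 hPM hc hd hb
  have hmap : ∀ r : R, φ r ∈ locAlg R K P := fun r => algebraMap_mem _ r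
  have key : ∀ b : K, b ∈ locAlg R K P ∨ b⁻¹ ∈ locAlg R K P := by
    intro b
    obtain ⟨x, y, h1, hx, hy⟩ := (hfs _ (span_pair_ne_bot (g := b) one_ne_zero)
      (Submodule.fg_span (by simp))).exists_of_span_pair
    set J := Submodule.span R {(1 : K), b} with hJ
    have m1 : (1 : K) ∈ J := Submodule.subset_span (by simp)
    have mb : b ∈ J := Submodule.subset_span (by simp)
    have hV : ∀ t ∈ J / J, t ∈ locAlg R K P := by
      intro t ht
      obtain ⟨v, w, h⟩ := Submodule.mem_span_pair.1 (ht _ m1)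
      obtain ⟨v', w', h'⟩ := Submodule.mem_span_pair.1 (ht _ mb)
      simp only [Algebra.smul_def, mul_one] at h h'
      refine hclaim t (φ w * φ v' - φ v * φ w') (φ v + φ w')
        (sub_mem (mul_mem (hmap _) (hmap _)) (mul_mem (hmap _) (hmap _)))
        (add_mem (hmap _) (hmap _)) ?_
      have : (t - φ v) * (t - φ w') = φ w * φ v' := by
        have e1 : t - φ v = φ w * b := by rw [← h]; ring
        have e2 : b * (t - φ w') = φ v' := by linear_combination -h'
        rw [e1, mul_assoc, e2]
      linear_combination this
    have hx1 := hV _ (hx _ m1)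
    have hxb := hV _ (hx _ mb)
    have hy1 := hV _ (hy _ m1)
    have hyb := hV _ (hy _ mb)
    rw [mul_one] at hx1 hy1
    rw [one_mul] at h1
    by_cases h : y * b ∈ locMax K hP
    · left
      obtain ⟨hne, hinv⟩ := one_sub_inv_mem_locAlg hP h
      have e : b = x * b * (1 - y * b)⁻¹ := by
        rw [eq_mul_inv_iff_mul_eq₀ hne]
        linear_combination (-b) * h1
      rw [e]
      exact mul_mem hxb hinv
    · right
      have hinv := inv_mem_locAlg hP hyb h
      have hne : y * b ≠ 0 := fun h0 => h (h0 ▸ (locMax K hP).zero_mem)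
      have e : b⁻¹ = y * (y * b)⁻¹ := by
        have hb0 := right_ne_zero_of_mul hne
        have hy0 := left_ne_zero_of_mul hne
        field_simp
      rw [e]
      exact mul_mem hy1 hinv
  intro x y
  by_cases hx : x = 0
  · right
    rw [hx]
    exact dvd_zero _
  by_cases hy : y = 0
  · left
    rw [hy]
    exact dvd_zero _
  have hx' : (x : K) ≠ 0 := by simpa using hx
  have hy' : (y : K) ≠ 0 := by simpa using hy
  rcases key (y / x : K) with h | h
  · left
    exact ⟨⟨_, h⟩, Subtype.ext (by simp; field_simp)⟩
  · right
    exact ⟨⟨_, h⟩, Subtype.ext (by simp; field_simp)⟩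

theorem StableDomain.stronglyDiscrete_locAlg (hst : StableDomain R K) (hP : P.IsPrime) :
    StronglyDiscrete (locAlg R K P) := by
  intro Q hQ hQ0 hQQ
  let I : Submodule R K :=
    { carrier := {x | ∃ r : R, x = φ r ∧ ∃ q ∈ Q, (q : K) = x}
      zero_mem' := ⟨0, by simp, 0, Q.zero_mem, by simp⟩
      add_mem' := by
        rintro _ _ ⟨r, rfl, q, hq, h⟩ ⟨r', rfl, q', hq', h'⟩
        exact ⟨r + r', by simp, q + q', Q.add_mem hq hq', by simp [h, h']⟩
      smul_mem' := by
        rintro c _ ⟨r, rfl, q, hq, h⟩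
        refine ⟨c * r, by simp [Algebra.smul_def], algebraMap R (locAlg R K P) c * q,
          Q.mul_mem_left _ hq, ?_⟩
        rw [← h, Algebra.smul_def]
        rfl }
  have hI : ∀ x, x ∈ I ↔ ∃ r : R, x = φ r ∧ ∃ q ∈ Q, (q : K) = x := fun x => Iff.rfl
  have hlift : ∀ q ∈ Q, ∃ i ∈ I, ∃ s : R, s ∉ P ∧ (q : K) = i / φ s := by
    intro q hq
    obtain ⟨r, s, hs, h⟩ := (mem_locAlg_iff hP).1 q.2
    have hs0 : φ s ≠ 0 := algebraMap_ne_zero_of_notMem hs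
    refine ⟨φ r, (hI _).2 ⟨r, rfl, algebraMap R (locAlg R K P) s * q, Q.mul_mem_left _ hq, ?_⟩,
      s, hs, h⟩
    change φ s * (q : K) = φ r
    rw [h]
    field_simp
  have hfrac : IsFrac R K I := by
    refine ⟨fun h => hQ0 ?_, 1, one_ne_zero, fun x hx => ?_⟩
    · rw [eq_bot_iff]
      intro q hq
      obtain ⟨i, hi, s, hs, e⟩ := hlift q hq
      rw [h, Submodule.mem_bot] at hi
      rw [hi, zero_div] at e
      simpa using e
    · obtain ⟨r, hr, -⟩ := (hI _).1 hx
      exact ⟨r, by simp [hr]⟩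
  have h1 := (hst I hfrac).one_mem
  have hdivV : ∀ t ∈ I, ∀ s : R, s ∉ P → ∃ q ∈ Q, (q : K) = t / φ s := by
    intro t ht s hs
    obtain ⟨r, -, q, hq, h⟩ := (hI _).1 ht
    refine ⟨⟨(φ s)⁻¹, Algebra.subset_adjoin ⟨s, hs, rfl⟩⟩ * q, Q.mul_mem_left _ hq, ?_⟩
    rw [← h, div_eq_inv_mul]
    rfl
  have hXQ : ∀ x ∈ (I / I) / I, ∀ q ∈ Q * Q, ∃ q' ∈ Q, (q' : K) = x * q := by
    intro x hx q hq
    refine Submodule.mul_induction_on hq ?_ ?_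
    · intro a ha b hb
      obtain ⟨i, hi, s, hs, e⟩ := hlift a ha
      obtain ⟨i', hi', s', hs', e'⟩ := hlift b hb
      obtain ⟨q', hq', h⟩ := hdivV _ (hx i hi i' hi') (s * s')
        fun h => (hP.mem_or_mem h).elim hs hs'
      refine ⟨q', hq', ?_⟩
      rw [h]
      simp only [MulMemClass.coe_mul, e, e', map_mul]
      have hs0 : φ s ≠ 0 := algebraMap_ne_zero_of_notMem hs
      have hs0' : φ s' ≠ 0 := algebraMap_ne_zero_of_notMem hs'
      field_simp
    · rintro a b ⟨a', ha', h⟩ ⟨b', hb', h'⟩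
      exact ⟨a' + b', Q.add_mem ha' hb', by simp [h, h', mul_add]⟩
  have hone : ∀ z ∈ I * ((I / I) / I), ∃ q ∈ Q, (q : K) = z := by
    intro z hz
    refine Submodule.mul_induction_on hz ?_ ?_
    · intro i hi x hx
      obtain ⟨r, -, q, hq, h⟩ := (hI _).1 hi
      obtain ⟨q', hq', h'⟩ := hXQ x hx q (hQQ.symm ▸ hq)
      exact ⟨q', hq', by rw [h', h, mul_comm]⟩
    · rintro a b ⟨a', ha', h⟩ ⟨b', hb', h'⟩
      exact ⟨a' + b', Q.add_mem ha' hb', by simp [h, h']⟩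
  obtain ⟨q, hq, h⟩ := hone 1 h1
  have : q = 1 := Subtype.ext h
  exact hQ.ne_top ((Ideal.eq_top_iff_one _).2 (this ▸ hq))

end Localization

section Domination

variable {R K : Type*} [CommRing R] [IsLocalRing R] [Field K] [Algebra R K]

local notation "φ" => algebraMap R K

/-- A valuation which is at most `1` on the integral closure of the local ring `R` and less than `1`
on the maximal ideal of `R`. -/
structure Valuation.DominatesIntegral (R : Type*) {K Γ : Type*} [CommRing R] [IsLocalRing R]
    [Field K] [Algebra R K] [LinearOrderedCommGroupWithZero Γ] (v : Valuation K Γ) : Prop where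
  le_one_of_isIntegral : ∀ x : K, IsIntegral R x → v x ≤ 1
  lt_one_of_mem : ∀ m ∈ IsLocalRing.maximalIdeal R, v (algebraMap R K m) < 1

section Valuation

variable {Γ : Type*} [LinearOrderedCommGroupWithZero Γ] {v : Valuation K Γ}

theorem Valuation.mul_lt_one_of_le_of_lt {x y : K} (hx : v x ≤ 1) (hy : v y < 1) :
    v (x * y) < 1 := by
  rw [map_mul]
  exact (mul_le_of_le_one_left' hx).trans_lt hy

theorem Valuation.lt_one_of_mul_lt_one {x y : K} (hy : v y = 1) (h : v (x * y) < 1) :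
    v x < 1 := by
  rwa [map_mul, hy, mul_one] at h

theorem Valuation.DominatesIntegral.map_le_one (h : v.DominatesIntegral R) (r : R) :
    v (φ r) ≤ 1 :=
  h.le_one_of_isIntegral _ isIntegral_algebraMap

theorem Valuation.DominatesIntegral.map_lt_one_iff (h : v.DominatesIntegral R) {r : R} :
    v (φ r) < 1 ↔ r ∈ IsLocalRing.maximalIdeal R := by
  refine ⟨fun hr => ?_, h.lt_one_of_mem r⟩
  rw [IsLocalRing.mem_maximalIdeal, mem_nonunits_iff]
  rintro ⟨u, rfl⟩
  have := v.mul_lt_one_of_le_of_lt (h.map_le_one (↑u⁻¹ : R)) hr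
  rw [← map_mul, Units.inv_mul, map_one, map_one] at this
  exact lt_irrefl _ this

theorem Valuation.DominatesIntegral.map_eq_one (h : v.DominatesIntegral R) {r : R}
    (hr : r ∉ IsLocalRing.maximalIdeal R) : v (φ r) = 1 :=
  le_antisymm (h.map_le_one r) (not_lt.1 fun h' => hr (h.map_lt_one_iff.1 h'))

end Valuation

theorem exists_mul_eq_one_of_notMem_maximalIdeal {c : R} (hc : c ∉ IsLocalRing.maximalIdeal R) :
    ∃ u : R, u * c = 1 := by
  rw [IsLocalRing.mem_maximalIdeal, mem_nonunits_iff, not_not] at hc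
  exact hc.exists_left_inv

variable {Γ₁ Γ₂ : Type*} [LinearOrderedCommGroupWithZero Γ₁] [LinearOrderedCommGroupWithZero Γ₂]
  {v₁ : Valuation K Γ₁} {v₂ : Valuation K Γ₂}

theorem exists_eq_add_mul_of_mul_eq
    (hfs : ∀ I : Submodule R K, I ≠ ⊥ → I.FG → IsStableIdeal R K I)
    (h₁ : v₁.DominatesIntegral R) (h₂ : v₂.DominatesIntegral R) {v e : K} {p r β : R}
    (hvv : v * v = v + φ β) (hv₁ : v₁ (1 - v) < 1) (hv₂ : v₂ v < 1) (hvi : IsIntegral R v)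
    (hei : IsIntegral R e) (hβ : β ∈ IsLocalRing.maximalIdeal R)
    (hr : r ∈ IsLocalRing.maximalIdeal R) (hev : e * v = φ p + φ r * e) :
    ∃ c d : R, e = φ c + φ d * v := by
  by_contra hne
  set M := IsLocalRing.maximalIdeal R with hM
  have hp : p ∈ M := by
    refine h₂.map_lt_one_iff.1 ?_
    have : φ p = e * (v - φ r) := by linear_combination -hev
    rw [this]
    exact v₂.mul_lt_one_of_le_of_lt (h₂.le_one_of_isIntegral _ hei)
      (v₂.map_sub_lt hv₂ (h₂.lt_one_of_mem r hr))
  have he₁ : v₁ e < 1 := by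
    have h1 : v₁ (v - φ r) = 1 := by
      have : v - φ r = 1 + -((1 - v) + φ r) := by ring
      rw [this]
      refine v₁.map_one_add_of_lt ?_
      rw [Valuation.map_neg]
      exact v₁.map_add_lt hv₁ (h₁.lt_one_of_mem r hr)
    refine v₁.lt_one_of_mul_lt_one h1 ?_
    have : e * (v - φ r) = φ p := by linear_combination hev
    rw [this]
    exact h₁.lt_one_of_mem p hp
  obtain ⟨a, b, hab⟩ := exists_sq_eq_of_isIntegral hfs hei
  have hb : b ∈ M := by
    refine h₁.map_lt_one_iff.1 ?_
    have : φ b = (e - φ a) * e := by linear_combination -hab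
    rw [this]
    exact v₁.mul_lt_one_of_le_of_lt
      (h₁.le_one_of_isIntegral _ (hei.sub isIntegral_algebraMap)) he₁
  have hei₂ := h₂.le_one_of_isIntegral _ hei
  set f := v + e with hf
  set g := 1 - v with hg
  have hf₁ : v₁ f = 1 := by
    have : f = 1 + -(g - e) := by rw [hf, hg]; ring
    rw [this]
    refine v₁.map_one_add_of_lt ?_
    rw [Valuation.map_neg]
    exact v₁.map_sub_lt hv₁ he₁
  have hf₂ : v₂ f ≤ 1 := h₂.le_one_of_isIntegral _ (hvi.add hei)
  have hg₂ : v₂ g = 1 := by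
    have : g = 1 + -v := by rw [hg]; ring
    rw [this]
    refine v₂.map_one_add_of_lt ?_
    rwa [Valuation.map_neg]
  have hf0 : f ≠ 0 := by
    intro h
    rw [h, map_zero] at hf₁
    exact zero_ne_one hf₁
  have hJ0 : Submodule.span R {f, g} ≠ ⊥ := span_pair_ne_bot hf0
  have hJfg : (Submodule.span R {f, g}).FG := Submodule.fg_span (by simp)
  obtain ⟨x, y, h1, hx, hy⟩ := (hfs _ hJ0 hJfg).exists_of_span_pair
  set J := Submodule.span R {f, g} with hJ
  have mf : f ∈ J := Submodule.subset_span (by simp)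
  have mg : g ∈ J := Submodule.subset_span (by simp)
  have hconst : ∀ t ∈ J / J, ∃ l : R, v₁ (t - φ l) < 1 ∧ v₂ (t - φ l) < 1 := by
    intro t ht
    obtain ⟨l, m, hlm⟩ := Submodule.mem_span_pair.1 (ht _ mf)
    obtain ⟨l', m', hlm'⟩ := Submodule.mem_span_pair.1 (ht _ mg)
    simp only [Algebra.smul_def] at hlm hlm'
    obtain ⟨c0, hc0⟩ : ∃ c0, c0 =
      -l * (β + p) + m * (1 + β) - l' * (β + 2 * p + b) + m' * (β + p) := ⟨_, rfl⟩
    obtain ⟨c1, hc1⟩ : ∃ c1, c1 = -m - l' := ⟨_, rfl⟩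
    obtain ⟨c2, hc2⟩ : ∃ c2, c2 = l * (1 - r) - l' * (a + 2 * r) - m' * (1 - r) := ⟨_, rfl⟩
    have hrel : φ c0 + φ c1 * v + φ c2 * e = 0 := by
      have h3 : (φ l * f + φ m * g) * g = (φ l' * f + φ m' * g) * f := by
        rw [hlm, hlm']; ring
      have hfg : f * g = (1 - φ r) * e - (φ β + φ p) := by
        rw [hf, hg]; linear_combination -hvv - hev
      have hgg : g * g = 1 - v + φ β := by rw [hg]; linear_combination hvv
      have hff : f * f = v + (φ a + 2 * φ r) * e + (φ β + 2 * φ p + φ b) := by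
        rw [hf]; linear_combination hvv + 2 * hev + hab
      rw [hc0, hc1, hc2]
      simp only [map_add, map_sub, map_mul, map_neg, map_one, map_ofNat]
      linear_combination h3 + (φ l' * hff) + (φ m' - φ l) * hfg - φ m * hgg
    have hc2M : c2 ∈ M := by
      by_contra h
      obtain ⟨u, hu⟩ := exists_mul_eq_one_of_notMem_maximalIdeal h
      refine hne ⟨-u * c0, -u * c1, ?_⟩
      have hu' : φ u * φ c2 = 1 := by rw [← map_mul, hu, map_one]
      simp only [map_mul, map_neg]
      linear_combination φ u * hrel - e * hu'
    have hc0M : c0 ∈ M := by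
      refine h₂.map_lt_one_iff.1 ?_
      have : φ c0 = -(φ c1 * v + e * φ c2) := by linear_combination hrel
      rw [this, Valuation.map_neg]
      exact v₂.map_add_lt (v₂.mul_lt_one_of_le_of_lt (h₂.map_le_one _) hv₂)
        (v₂.mul_lt_one_of_le_of_lt hei₂ (h₂.lt_one_of_mem _ hc2M))
    have hc1M : c1 ∈ M := by
      have : c0 + c1 ∈ M := by
        refine h₁.map_lt_one_iff.1 ?_
        have : φ (c0 + c1) = φ c1 * g - φ c2 * e := by
          rw [map_add, hg]; linear_combination hrel
        rw [this]
        exact v₁.map_sub_lt (v₁.mul_lt_one_of_le_of_lt (h₁.map_le_one _) hv₁)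
          (v₁.mul_lt_one_of_le_of_lt (h₁.map_le_one _) he₁)
      simpa using M.sub_mem this hc0M
    have hmM : m ∈ M := by
      have : m = c0 + (l - m') * (β + p) - m * β + l' * (β + 2 * p + b) := by rw [hc0]; ring
      rw [this]
      exact M.add_mem (M.sub_mem (M.add_mem hc0M (M.mul_mem_left _ (M.add_mem hβ hp)))
        (M.mul_mem_left _ hβ))
        (M.mul_mem_left _ (M.add_mem (M.add_mem hβ (M.mul_mem_left _ hp)) hb))
    have hl'M : l' ∈ M := by
      have : l' = -c1 - m := by rw [hc1]; ring
      rw [this]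
      exact M.sub_mem (M.neg_mem hc1M) hmM
    have hlm'M : m' - l ∈ M := by
      have : m' - l = -c2 + (m' - l) * r - (a + 2 * r) * l' := by rw [hc2]; ring
      rw [this]
      exact M.sub_mem (M.add_mem (M.neg_mem hc2M) (M.mul_mem_left _ hr)) (M.mul_mem_left _ hl'M)
    refine ⟨l, v₁.lt_one_of_mul_lt_one hf₁ ?_, v₂.lt_one_of_mul_lt_one hg₂ ?_⟩
    · have : (t - φ l) * f = φ m * g := by linear_combination -hlm
      rw [this]
      exact v₁.mul_lt_one_of_le_of_lt (h₁.map_le_one _) hv₁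
    · have : (t - φ l) * g = f * φ l' + g * φ (m' - l) := by
        rw [map_sub]; linear_combination -hlm'
      rw [this]
      exact v₂.map_add_lt (v₂.mul_lt_one_of_le_of_lt hf₂ (h₂.lt_one_of_mem _ hl'M))
        (v₂.mul_lt_one_of_le_of_lt hg₂.le (h₂.lt_one_of_mem _ hlm'M))
  have htrans : ∀ t ∈ J / J, v₁ t < 1 → v₂ t < 1 := by
    intro t ht h
    obtain ⟨l, hl₁, hl₂⟩ := hconst t ht
    have hlM : l ∈ M := by
      refine h₁.map_lt_one_iff.1 ?_
      have := v₁.map_sub_lt h hl₁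
      rwa [sub_sub_cancel] at this
    have := v₂.map_add_lt hl₂ (h₂.lt_one_of_mem l hlM)
    rwa [sub_add_cancel] at this
  have hle : ∀ t ∈ J / J, v₁ t ≤ 1 := fun t ht =>
    h₁.le_one_of_isIntegral _ (isIntegral_of_mem_div_self hJ0 hJfg ht)
  have hkey : ∀ z : K, (∀ j ∈ J, z * j ∈ J / J) → v₂ (z * g) < 1 := by
    intro z hz
    refine htrans _ (hz _ mg) (v₁.lt_one_of_mul_lt_one hf₁ ?_)
    have : z * g * f = z * f * g := by ring
    rw [this]
    exact v₁.mul_lt_one_of_le_of_lt (hle _ (hz _ mf)) hv₁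
  have hfx : v₂ (f * x) < 1 := by
    refine v₂.lt_one_of_mul_lt_one hg₂ ?_
    have : f * x * g = f * (x * g) := by ring
    rw [this]
    exact v₂.mul_lt_one_of_le_of_lt hf₂ (hkey x hx)
  have hgy : v₂ (g * y) < 1 := by
    rw [mul_comm]
    exact hkey y hy
  have := v₂.map_add_lt hfx hgy
  rw [h1, map_one] at this
  exact lt_irrefl _ this

/-- If an integral element `t` is separated by two dominating valuations, then `1` and `t` generate
the integral closure of a finitely stable local domain as a module. -/
theorem exists_eq_add_mul_of_separated
    (hfs : ∀ I : Submodule R K, I ≠ ⊥ → I.FG → IsStableIdeal R K I)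
    (h₁ : v₁.DominatesIntegral R) (h₂ : v₂.DominatesIntegral R) {t : K} (hti : IsIntegral R t)
    (ht₁ : v₁ t = 1) (ht₂ : v₂ t < 1) {e : K} (hei : IsIntegral R e) :
    ∃ c d : R, e = φ c + φ d * t := by
  set M := IsLocalRing.maximalIdeal R with hM
  obtain ⟨α, β₀, htt⟩ := exists_sq_eq_of_isIntegral hfs hti
  have hβ₀ : β₀ ∈ M := by
    refine h₂.map_lt_one_iff.1 ?_
    have : φ β₀ = (t - φ α) * t := by linear_combination -htt
    rw [this]
    exact v₂.mul_lt_one_of_le_of_lt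
      (h₂.le_one_of_isIntegral _ (hti.sub isIntegral_algebraMap)) ht₂
  have hα : α ∉ M := by
    intro hα
    have : v₁ (t * t) < 1 := by
      rw [htt, mul_comm (φ α)]
      exact v₁.map_add_lt (v₁.mul_lt_one_of_le_of_lt ht₁.le (h₁.lt_one_of_mem _ hα))
        (h₁.lt_one_of_mem _ hβ₀)
    rw [map_mul, ht₁, mul_one] at this
    exact lt_irrefl _ this
  obtain ⟨u, hu⟩ := exists_mul_eq_one_of_notMem_maximalIdeal hα
  have hu' : φ u * φ α = 1 := by rw [← map_mul, hu, map_one]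
  obtain ⟨v, hv⟩ : ∃ v, v = φ u * t := ⟨_, rfl⟩
  suffices h : ∃ c d : R, e = φ c + φ d * v by
    obtain ⟨c, d, h⟩ := h
    exact ⟨c, d * u, by rw [h, hv, map_mul]; ring⟩
  have hvi : IsIntegral R v := hv ▸ isIntegral_algebraMap.mul hti
  obtain ⟨β, hβd⟩ : ∃ β, β = u * u * β₀ := ⟨_, rfl⟩
  have hβ : β ∈ M := hβd ▸ M.mul_mem_left _ hβ₀
  have hvv : v * v = v + φ β := by
    rw [hv, hβd]
    simp only [map_mul]
    linear_combination φ u * φ u * htt + φ u * t * hu'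
  have hv₂ : v₂ v < 1 := hv ▸ v₂.mul_lt_one_of_le_of_lt (h₂.map_le_one _) ht₂
  have huM : u ∉ M := fun h => by
    have : (1 : R) ∈ M := hu ▸ M.mul_mem_right _ h
    exact (Ideal.ne_top_iff_one M).1 (IsLocalRing.maximalIdeal.isMaximal R).ne_top this
  have hvv₁ : v₁ v = 1 := by rw [hv, map_mul, h₁.map_eq_one huM, ht₁, one_mul]
  have hv₁ : v₁ (1 - v) < 1 := by
    refine v₁.lt_one_of_mul_lt_one hvv₁ ?_
    have : (1 - v) * v = -φ β := by linear_combination -hvv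
    rw [this, Valuation.map_neg]
    exact h₁.lt_one_of_mem _ hβ
  obtain ⟨p, q, r, hev⟩ := exists_mul_eq_of_isIntegral hfs hei hvi
  obtain ⟨e', he'⟩ : ∃ e', e' = e - φ r := ⟨_, rfl⟩
  suffices h : ∃ c d : R, e' = φ c + φ d * v by
    obtain ⟨c, d, h⟩ := h
    exact ⟨c + r, d, by rw [map_add]; linear_combination h - he'⟩
  have he'i : IsIntegral R e' := he' ▸ hei.sub isIntegral_algebraMap
  have he'v : e' * v = φ (p + q * r) + φ q * e' := by
    rw [he']
    simp only [map_mul, map_add]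
    linear_combination hev
  by_cases hq : q ∈ M
  · exact exists_eq_add_mul_of_mul_eq hfs h₁ h₂ hvv hv₁ hv₂ hvi he'i hβ hq he'v
  by_cases hq' : 1 - q ∈ M
  · obtain ⟨c, d, h⟩ := exists_eq_add_mul_of_mul_eq hfs h₂ h₁ (v := 1 - v) (e := e')
      (p := -(p + q * r)) (r := 1 - q) (β := β) (by linear_combination hvv)
      (by rwa [sub_sub_cancel]) hv₁ (isIntegral_one.sub hvi) he'i hβ hq' (by
        rw [map_neg, map_sub, map_one]
        linear_combination -he'v)
    exact ⟨c + d, -d, by rw [h, map_add, map_neg]; ring⟩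
  · have hunit : β + q * (1 - q) ∉ M := by
      intro h
      have h' : q * (1 - q) ∈ M := by simpa using M.sub_mem h hβ
      exact ((IsLocalRing.maximalIdeal.isMaximal R).isPrime.mem_or_mem h').elim hq hq'
    obtain ⟨w, hw⟩ := exists_mul_eq_one_of_notMem_maximalIdeal hunit
    have hw' : φ w * (φ β + φ q * (1 - φ q)) = 1 := by
      rw [← map_one φ, ← map_sub, ← map_mul, ← map_add, ← map_mul, hw]
    refine ⟨w * (p + q * r) * (q - 1), w * (p + q * r), ?_⟩
    simp only [map_mul, map_sub, map_one]
    linear_combination (-e') * hw' + φ w * (v - 1 + φ q) * he'v - φ w * e' * hvv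

end Domination

section Dominating

variable {R K : Type*} [CommRing R] [IsLocalRing R] [Field K] [Algebra R K]

local notation "φ" => algebraMap R K

local notation "𝓑" => Subalgebra.toSubring (integralClosure R K)

theorem one_sub_mul_mul_eq_one
    (hfs : ∀ I : Submodule R K, I ≠ ⊥ → I.FG → IsStableIdeal R K I) {m : R}
    (hm : m ∈ IsLocalRing.maximalIdeal R) {y : K} (hy : IsIntegral R y) :
    ∃ z : K, IsIntegral R z ∧ z * (1 - φ m * y) = 1 := by
  obtain ⟨a, b, hab⟩ := exists_sq_eq_of_isIntegral hfs hy
  have hu : 1 - (m * a + m * m * b) ∉ IsLocalRing.maximalIdeal R := by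
    rw [IsLocalRing.mem_maximalIdeal, mem_nonunits_iff, not_not]
    refine IsLocalRing.isUnit_one_sub_self_of_mem_nonunits _ ((IsLocalRing.mem_maximalIdeal _).1 ?_)
    exact Ideal.add_mem _ (Ideal.mul_mem_right _ _ hm)
      (Ideal.mul_mem_right _ _ (Ideal.mul_mem_left _ _ hm))
  obtain ⟨u, hu⟩ := exists_mul_eq_one_of_notMem_maximalIdeal hu
  have hu' : φ u * (1 - (φ m * φ a + φ m * φ m * φ b)) = 1 := by
    simpa only [map_mul, map_sub, map_add, map_one] using congrArg φ hu
  refine ⟨φ u * (1 - φ m * φ a + φ m * y), ?_, ?_⟩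
  · exact isIntegral_algebraMap.mul ((isIntegral_one.sub
      (isIntegral_algebraMap.mul isIntegral_algebraMap)).add (isIntegral_algebraMap.mul hy))
  · linear_combination hu' - φ u * φ m * φ m * hab

theorem exists_dominatesIntegral
    (hfs : ∀ I : Submodule R K, I ≠ ⊥ → I.FG → IsStableIdeal R K I) {N : Ideal 𝓑}
    (hN : N.IsMaximal) :
    ∃ A : ValuationSubring K, A.valuation.DominatesIntegral R ∧
      ∀ x : 𝓑, x ∈ N ↔ A.valuation (x : K) < 1 := by
  obtain ⟨A, hA, hNA⟩ := Ideal.image_subset_nonunits_valuationSubring N hN.ne_top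
  have h1 : ∀ x ∈ N, A.valuation (x : K) < 1 := fun x hx => hNA ⟨x, hx, rfl⟩
  have hle : ∀ x : 𝓑, A.valuation (x : K) ≤ 1 := fun x =>
    (A.valuation_le_one_iff _).2 (hA x.2)
  have hiff : ∀ x : 𝓑, x ∈ N ↔ A.valuation (x : K) < 1 := by
    refine fun x => ⟨h1 x, fun hx => ?_⟩
    by_contra hxN
    obtain ⟨y, n, hn, h⟩ := hN.exists_inv hxN
    have h' : (y : K) * x + n = 1 := congrArg Subtype.val h
    have := A.valuation.map_add_lt (A.valuation.mul_lt_one_of_le_of_lt (hle y) hx) (h1 n hn)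
    rw [h', map_one] at this
    exact lt_irrefl _ this
  refine ⟨A, ⟨fun x hx => hle ⟨x, hx⟩, fun m hm => ?_⟩, hiff⟩
  have hmB : IsIntegral R (φ m) := isIntegral_algebraMap
  refine (hiff ⟨φ m, hmB⟩).1 ?_
  by_contra hmN
  obtain ⟨y, n, hn, h⟩ := hN.exists_inv hmN
  have h' : (y : K) * φ m + n = 1 := congrArg Subtype.val h
  obtain ⟨z, hz, hzm⟩ := one_sub_mul_mul_eq_one hfs hm y.2
  refine hN.ne_top ((Ideal.eq_top_iff_one N).2 ?_)
  have : (⟨z, hz⟩ : 𝓑) * n = 1 := by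
    refine Subtype.ext ?_
    change z * (n : K) = 1
    rw [← hzm]
    linear_combination z * h'
  rw [← this]
  exact N.mul_mem_left _ hn

omit [IsLocalRing R] in
theorem isIntegral_of_mem_of_mem
    (hfs : ∀ I : Submodule R K, I ≠ ⊥ → I.FG → IsStableIdeal R K I) {N₁ N₂ : Ideal 𝓑}
    (hN : ∀ N : Ideal 𝓑, N.IsMaximal → N = N₁ ∨ N = N₂) {A₁ A₂ : ValuationSubring K}
    (h₁ : ∀ x : 𝓑, x ∈ N₁ ↔ A₁.valuation (x : K) < 1)
    (h₂ : ∀ x : 𝓑, x ∈ N₂ ↔ A₂.valuation (x : K) < 1) {z : K} (hz₁ : z ∈ A₁) (hz₂ : z ∈ A₂) :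
    IsIntegral R z := by
  by_contra hz
  let C : Ideal 𝓑 :=
    { carrier := {b | (b : K) * z ∈ 𝓑}
      zero_mem' := by simp
      add_mem' := by
        intro a b ha hb
        change ((a : K) + b) * z ∈ 𝓑
        rw [add_mul]
        exact add_mem ha hb
      smul_mem' := by
        intro c a ha
        change ((c : K) * a) * z ∈ 𝓑
        rw [mul_assoc]
        exact mul_mem c.2 ha }
  have hC : ∀ b : 𝓑, b ∈ C ↔ IsIntegral R ((b : K) * z) := fun b => Iff.rfl
  have hCtop : C ≠ ⊤ := by
    intro h
    have := (hC 1).1 ((Ideal.eq_top_iff_one _).1 h)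
    rw [Subring.coe_one, one_mul] at this
    exact hz this
  obtain ⟨x, y, h1, hx, hzx, hy, hzy⟩ := exists_isIntegral_add_mul_eq_one hfs z
  have hxC : (⟨x, hx⟩ : 𝓑) ∈ C := (hC _).2 (by rwa [mul_comm])
  have hyC : (⟨y, hy⟩ : 𝓑) ∈ C := (hC _).2 (by rwa [mul_comm])
  obtain ⟨N, hNmax, hCN⟩ := Ideal.exists_le_maximal C hCtop
  obtain ⟨A, hA, hzA⟩ : ∃ A : ValuationSubring K,
      (∀ x : 𝓑, x ∈ N ↔ A.valuation (x : K) < 1) ∧ z ∈ A := by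
    rcases hN N hNmax with rfl | rfl
    exacts [⟨A₁, h₁, hz₁⟩, ⟨A₂, h₂, hz₂⟩]
  have hvx := (hA _).1 (hCN hxC)
  have hvy := A.valuation.mul_lt_one_of_le_of_lt ((A.valuation_le_one_iff _).2 hzA)
    ((hA _).1 (hCN hyC))
  have := A.valuation.map_add_lt hvx hvy
  rw [h1, map_one] at this
  exact lt_irrefl _ this

/-- The integral closure of a finitely stable local domain is the intersection of at most two
valuation rings dominating the domain, which are separated by integral elements. -/
theorem exists_valuationSubring_pair
    (hfs : ∀ I : Submodule R K, I ≠ ⊥ → I.FG → IsStableIdeal R K I) :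
    ∃ A₁ A₂ : ValuationSubring K, A₁.valuation.DominatesIntegral R ∧
      A₂.valuation.DominatesIntegral R ∧ (∀ x, x ∈ A₁ → x ∈ A₂ → IsIntegral R x) ∧
      (A₁ = A₂ ∨ (∃ t, IsIntegral R t ∧ A₁.valuation t = 1 ∧ A₂.valuation t < 1) ∧
        (∃ t, IsIntegral R t ∧ A₂.valuation t = 1 ∧ A₁.valuation t < 1)) := by
  by_cases hex : ∃ N₁ N₂ : Ideal 𝓑, N₁.IsMaximal ∧ N₂.IsMaximal ∧ N₁ ≠ N₂
  · obtain ⟨N₁, N₂, hN₁, hN₂, hne⟩ := hex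
    obtain ⟨A₁, hd₁, h₁⟩ := exists_dominatesIntegral hfs hN₁
    obtain ⟨A₂, hd₂, h₂⟩ := exists_dominatesIntegral hfs hN₂
    obtain ⟨t, htN₂, htN₁⟩ : ∃ t ∈ N₂, t ∉ N₁ := by
      by_contra! h
      exact hne (hN₂.eq_of_le hN₁.ne_top h).symm
    obtain ⟨t', htN₁', htN₂'⟩ : ∃ t ∈ N₁, t ∉ N₂ := by
      by_contra! h
      exact hne (hN₁.eq_of_le hN₂.ne_top h)
    have hsep : ∀ (A : ValuationSubring K) (N : Ideal 𝓑), A.valuation.DominatesIntegral R →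
        (∀ x : 𝓑, x ∈ N ↔ A.valuation (x : K) < 1) → ∀ t : 𝓑, t ∉ N →
        A.valuation (t : K) = 1 := fun A N hd h t ht =>
      le_antisymm (hd.le_one_of_isIntegral _ t.2) (not_lt.1 fun h' => ht ((h t).2 h'))
    have ht₁ := hsep A₁ N₁ hd₁ h₁ t htN₁
    have ht₂ := (h₂ t).1 htN₂
    refine ⟨A₁, A₂, hd₁, hd₂, fun x hx₁ hx₂ => isIntegral_of_mem_of_mem hfs (fun N hN => ?_)
      h₁ h₂ hx₁ hx₂, Or.inr ⟨⟨t, t.2, ht₁, ht₂⟩,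
        ⟨t', t'.2, hsep A₂ N₂ hd₂ h₂ t' htN₂', (h₁ t').1 htN₁'⟩⟩⟩
    obtain ⟨A, hd, h⟩ := exists_dominatesIntegral hfs hN
    obtain ⟨α, β, htt⟩ := exists_sq_eq_of_isIntegral hfs t.2
    have hβ : β ∈ IsLocalRing.maximalIdeal R := by
      refine hd₂.map_lt_one_iff.1 ?_
      have : φ β = ((t : K) - φ α) * t := by linear_combination -htt
      rw [this]
      exact A₂.valuation.mul_lt_one_of_le_of_lt
        (hd₂.le_one_of_isIntegral _ (t.2.sub isIntegral_algebraMap)) ht₂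
    have hrep : ∀ x : 𝓑, ∃ c d : R, (x : K) = φ c + φ d * t := fun x =>
      exists_eq_add_mul_of_separated hfs hd₁ hd₂ t.2 ht₁ ht₂ x.2
    by_cases htN : t ∈ N
    · right
      refine hN.eq_of_le hN₂.ne_top fun x hx => (h₂ x).2 ?_
      obtain ⟨c, d, hcd⟩ := hrep x
      have hc : A.valuation (φ c) < 1 := by
        have : φ c = x - φ d * t := by rw [hcd]; ring
        rw [this]
        exact A.valuation.map_sub_lt ((h x).1 hx)
          (A.valuation.mul_lt_one_of_le_of_lt (hd.map_le_one d) ((h t).1 htN))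
      rw [hcd]
      exact A₂.valuation.map_add_lt (hd₂.lt_one_of_mem c (hd.map_lt_one_iff.1 hc))
        (A₂.valuation.mul_lt_one_of_le_of_lt (hd₂.map_le_one d) ht₂)
    · left
      refine hN.eq_of_le hN₁.ne_top fun x hx => (h₁ x).2 ?_
      obtain ⟨c, d, hcd⟩ := hrep x
      have hsub : ∀ A : ValuationSubring K, A.valuation.DominatesIntegral R →
          A.valuation (t : K) = 1 → A.valuation (φ d * (t - φ α)) < 1 := by
        intro A hd ht
        refine A.valuation.mul_lt_one_of_le_of_lt (hd.map_le_one _)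
          (A.valuation.lt_one_of_mul_lt_one ht ?_)
        have : ((t : K) - φ α) * t = φ β := by linear_combination htt
        rw [this]
        exact hd.lt_one_of_mem β hβ
      have hx' : (x : K) = φ (c + d * α) + φ d * (t - φ α) := by
        rw [hcd]
        simp only [map_add, map_mul]
        ring
      have hc : A.valuation (φ (c + d * α)) < 1 := by
        have : φ (c + d * α) = x - φ d * (t - φ α) := by rw [hx']; ring
        rw [this]
        exact A.valuation.map_sub_lt ((h x).1 hx) (hsub A hd (hsep A N hd h t htN))
      rw [hx']
      exact A₁.valuation.map_add_lt (hd₁.lt_one_of_mem _ (hd.map_lt_one_iff.1 hc))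
        (hsub A₁ hd₁ ht₁)
  · push Not at hex
    obtain ⟨N, hN⟩ := Ideal.exists_maximal 𝓑
    obtain ⟨A, hd, h⟩ := exists_dominatesIntegral hfs hN
    exact ⟨A, A, hd, hd, fun x hx₁ hx₂ => isIntegral_of_mem_of_mem hfs
      (fun N' hN' => Or.inl (hex N' N hN' hN)) h h hx₁ hx₂, Or.inl rfl⟩

end Dominating

section Estimates

variable {R K : Type*} [CommRing R] [Field K] [Algebra R K]

local notation "φ" => algebraMap R K

theorem ValuationSubring.valuation_le_valuation_iff {A : ValuationSubring K} {x y : K}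
    (hy : y ≠ 0) : A.valuation x ≤ A.valuation y ↔ x / y ∈ A := by
  have hy' : 0 < A.valuation y := zero_lt_iff.2 ((Valuation.ne_zero_iff _).2 hy)
  rw [← A.valuation_le_one_iff, map_div₀, div_le_one₀ hy']

theorem Submodule.exists_valuation_le_and_valuation_le {Γ₁ Γ₂ : Type*}
    [LinearOrderedCommGroupWithZero Γ₁] [LinearOrderedCommGroupWithZero Γ₂]
    (v₁ : Valuation K Γ₁) (v₂ : Valuation K Γ₂) {I : Submodule R K} {a₁ a₂ : K} (h₁ : a₁ ∈ I)
    (h₂ : a₂ ∈ I) : ∃ b ∈ I, v₁ a₁ ≤ v₁ b ∧ v₂ a₂ ≤ v₂ b := by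
  by_cases h : v₂ a₂ ≤ v₂ a₁
  · exact ⟨a₁, h₁, le_rfl, h⟩
  by_cases h' : v₁ a₁ ≤ v₁ a₂
  · exact ⟨a₂, h₂, h', le_rfl⟩
  rw [not_le] at h h'
  exact ⟨a₁ + a₂, I.add_mem h₁ h₂, (v₁.map_add_eq_of_lt_left h').ge,
    (v₂.map_add_eq_of_lt_right h).ge⟩

variable [IsLocalRing R]

theorem ValuationSubring.mem_of_mul_maximalIdeal
    (hfs : ∀ I : Submodule R K, I ≠ ⊥ → I.FG → IsStableIdeal R K I) {A : ValuationSubring K}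
    (hd : A.valuation.DominatesIntegral R) {t : K}
    (ht : ∀ x ∈ IsLocalRing.maximalIdeal R, ∃ y ∈ IsLocalRing.maximalIdeal R, t * φ x = φ y) :
    t ∈ A := by
  by_contra htA
  set v := A.valuation with hv
  have htv : 1 < v t := by
    rw [← not_le, hv, A.valuation_le_one_iff]
    exact htA
  have hsmall : ∀ z, v (t * z) ≤ 1 → v z < 1 := by
    intro z hz
    by_contra! h
    refine (htv.trans_le ?_).not_ge hz
    rw [map_mul]
    exact le_mul_of_one_le_right' h
  obtain ⟨x, y, h1, hx, htx, hy, hty⟩ := exists_isIntegral_add_mul_eq_one hfs t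
  have hx1 : v x < 1 := hsmall x (hd.le_one_of_isIntegral _ htx)
  have hy1 : v y < 1 := hsmall y (hd.le_one_of_isIntegral _ hty)
  have hty1 : v (t * y) = 1 := by
    have : t * y = 1 + -x := by linear_combination h1
    rw [this]
    exact v.map_one_add_of_lt (by rwa [Valuation.map_neg])
  obtain ⟨α, β, hyy⟩ := exists_sq_eq_of_isIntegral hfs hy
  have hβ : β ∈ IsLocalRing.maximalIdeal R := by
    refine hd.map_lt_one_iff.1 ?_
    have : φ β = (y - φ α) * y := by linear_combination -hyy
    rw [this]
    exact v.mul_lt_one_of_le_of_lt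
      (hd.le_one_of_isIntegral _ (hy.sub isIntegral_algebraMap)) hy1
  obtain ⟨β₁, hβ₁, hβ₁'⟩ := ht β hβ
  obtain ⟨β₂, hβ₂, hβ₂'⟩ := ht β₁ hβ₁
  have hsq : (t * y) * (t * y) = (t * φ α) * (t * y) + φ β₂ := by
    rw [← hβ₂', ← hβ₁']
    linear_combination t * t * hyy
  by_cases hα : α ∈ IsLocalRing.maximalIdeal R
  · obtain ⟨α₁, hα₁, hα₁'⟩ := ht α hα
    have : v ((t * y) * (t * y)) < 1 := by
      rw [hsq, hα₁', mul_comm (φ α₁)]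
      exact v.map_add_lt (v.mul_lt_one_of_le_of_lt hty1.le (hd.lt_one_of_mem _ hα₁))
        (hd.lt_one_of_mem _ hβ₂)
    rw [map_mul, hty1, mul_one] at this
    exact lt_irrefl _ this
  · have e : t * φ α * (t * y) = (t * y) * (t * y) - φ β₂ := by linear_combination -hsq
    have h2 : v (t * φ α * (t * y)) ≤ 1 := by
      rw [e]
      refine v.map_sub_le ?_ (hd.map_le_one _)
      rw [map_mul, hty1, mul_one]
    rw [map_mul, map_mul, hty1, mul_one, hd.map_eq_one hα, mul_one] at h2
    exact h2.not_gt htv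

omit [IsLocalRing R] in
theorem mem_idealK {I : Ideal R} {x : K} : x ∈ idealK R K I ↔ ∃ r ∈ I, φ r = x := Iff.rfl

theorem exists_forall_valuation_le_of_isStableIdeal
    (hfs : ∀ I : Submodule R K, I ≠ ⊥ → I.FG → IsStableIdeal R K I)
    (hM : IsStableIdeal R K (idealK R K (IsLocalRing.maximalIdeal R))) {A : ValuationSubring K}
    (hd : A.valuation.DominatesIntegral R) :
    ∃ a ∈ IsLocalRing.maximalIdeal R, ∀ x ∈ IsLocalRing.maximalIdeal R,
      A.valuation (φ x) ≤ A.valuation (φ a) := by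
  set M := IsLocalRing.maximalIdeal R with hMdef
  set J := idealK R K M with hJ
  have key : ∀ z ∈ J * ((J / J) / J), ∃ a ∈ M, ∀ x ∈ M,
      A.valuation (z * φ x) ≤ A.valuation (φ a) := by
    intro z hz
    refine Submodule.mul_induction_on hz ?_ ?_
    · intro i hi y hy
      obtain ⟨a, ha, rfl⟩ := mem_idealK.1 hi
      refine ⟨a, ha, fun x hx => ?_⟩
      have hyx : y * φ x ∈ A := by
        refine ValuationSubring.mem_of_mul_maximalIdeal hfs hd fun x' hx' => ?_
        obtain ⟨r, hr, h⟩ := mem_idealK.1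
          (hy _ (mem_idealK.2 ⟨x, hx, rfl⟩) _ (mem_idealK.2 ⟨x', hx', rfl⟩))
        exact ⟨r, hr, h.symm⟩
      rw [mul_assoc, map_mul]
      exact mul_le_of_le_one_right' ((A.valuation_le_one_iff _).2 hyx)
    · rintro z z' ⟨a, ha, h⟩ ⟨a', ha', h'⟩
      rcases le_total (A.valuation (φ a)) (A.valuation (φ a')) with hle | hle
      · refine ⟨a', ha', fun x hx => ?_⟩
        rw [add_mul]
        exact A.valuation.map_add_le ((h x hx).trans hle) (h' x hx)
      · refine ⟨a, ha, fun x hx => ?_⟩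
        rw [add_mul]
        exact A.valuation.map_add_le (h x hx) ((h' x hx).trans hle)
  obtain ⟨a, ha, h⟩ := key 1 hM.one_mem
  exact ⟨a, ha, fun x hx => by simpa using h x hx⟩

theorem Valuation.DominatesIntegral.map_mul_self_le {Γ : Type*}
    [LinearOrderedCommGroupWithZero Γ] {v : Valuation K Γ} (hd : v.DominatesIntegral R)
    (hfs : ∀ I : Submodule R K, I ≠ ⊥ → I.FG → IsStableIdeal R K I) {m : R}
    (hm : ∀ x ∈ IsLocalRing.maximalIdeal R, v (φ x) ≤ v (φ m)) {n : K} (hn : v n < 1) :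
    v (n * n) ≤ v (φ m) := by
  obtain ⟨x, y, h1, hx, hnx, hy, hny⟩ := exists_isIntegral_add_mul_eq_one hfs n
  have hx1 : v x = 1 := by
    have : x = 1 + -(y * n) := by linear_combination h1
    rw [this]
    refine v.map_one_add_of_lt ?_
    rw [Valuation.map_neg]
    exact v.mul_lt_one_of_le_of_lt (hd.le_one_of_isIntegral _ hy) hn
  have hb : v (n * x) = v n := by rw [map_mul, hx1, mul_one]
  generalize n * x = b at hnx hb
  obtain ⟨α, β, hab⟩ := exists_sq_eq_of_isIntegral hfs hnx
  have hβ' : φ β = (b - φ α) * b := by linear_combination -hab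
  have hβ : β ∈ IsLocalRing.maximalIdeal R := by
    refine hd.map_lt_one_iff.1 ?_
    rw [hβ']
    exact v.mul_lt_one_of_le_of_lt
      (hd.le_one_of_isIntegral _ (hnx.sub isIntegral_algebraMap)) (hb ▸ hn)
  have hnn : v (n * n) = v (b * b) := by rw [map_mul, map_mul, hb]
  rw [hnn]
  have hb1 : v b ≤ 1 := hd.le_one_of_isIntegral _ hnx
  by_cases hα : α ∈ IsLocalRing.maximalIdeal R
  · rw [hab]
    refine v.map_add_le ?_ (hm β hβ)
    rw [map_mul]
    exact (mul_le_of_le_one_right' hb1).trans (hm α hα)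
  · have h2 : v (b - φ α) = 1 := by
      rw [v.map_sub_eq_of_lt_right, hd.map_eq_one hα]
      rw [hd.map_eq_one hα, hb]
      exact hn
    have h3 : v b = v (φ β) := by rw [hβ', map_mul, h2, one_mul]
    rw [map_mul]
    exact (mul_le_of_le_one_right' hb1).trans (h3 ▸ hm β hβ)

theorem ValuationSubring.inv_mem_of_notMem {A U : ValuationSubring K} (hAU : A ≤ U)
    (hd : A.valuation.DominatesIntegral R)
    (hfs : ∀ I : Submodule R K, I ≠ ⊥ → I.FG → IsStableIdeal R K I) {m : R} (hm0 : φ m ≠ 0)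
    (hm : ∀ x ∈ IsLocalRing.maximalIdeal R, A.valuation (φ x) ≤ A.valuation (φ m)) {u : K}
    (hu : u ∈ U) (huA : u ∉ A) : (φ m)⁻¹ ∈ U := by
  have hu0 : u ≠ 0 := fun h => huA (h ▸ zero_mem A)
  have hlt : A.valuation u⁻¹ < 1 := by
    rw [map_inv₀]
    refine inv_lt_one_of_one_lt₀ ?_
    rw [← not_le, A.valuation_le_one_iff]
    exact huA
  have h := (ValuationSubring.valuation_le_valuation_iff hm0).1 (hd.map_mul_self_le hfs hm hlt)
  have e : (φ m)⁻¹ = u * u * (u⁻¹ * u⁻¹ / φ m) := by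
    field_simp
  rw [e]
  exact MulMemClass.mul_mem (MulMemClass.mul_mem hu hu) (hAU h)

omit [IsLocalRing R] in
/-- A submodule of `K` is, up to a fixed valuation and up to a scalar, an overring of the valuation
ring, as soon as the overrings have no idempotent maximal ideals. -/
theorem Submodule.exists_valuationSubring_of_forall_overring {A : ValuationSubring K}
    (hπ : ∀ U : ValuationSubring K, A ≤ U → (∃ x, x ∉ U) → ∃ π : K, π ≠ 0 ∧ U.valuation π < 1 ∧
      ∀ q q', U.valuation q < 1 → U.valuation q' < 1 → U.valuation (q * q') ≤ U.valuation π)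
    {I : Submodule R K} (hI : I ≠ ⊥) :
    ∃ a ∈ I, a ≠ 0 ∧ ∃ U : ValuationSubring K, A ≤ U ∧ (∀ x ∈ I, x / a ∈ U) ∧
      ∀ u ∈ U, ∃ x ∈ I, A.valuation (u * a) ≤ A.valuation x := by
  let S : Subring K :=
    { carrier := {u | ∀ x ∈ I, ∃ y ∈ I, A.valuation (u * x) ≤ A.valuation y}
      zero_mem' := fun x hx => ⟨x, hx, by simp⟩
      one_mem' := fun x hx => ⟨x, hx, by simp⟩
      add_mem' := by
        intro u u' hu hu' x hx
        obtain ⟨y, hy, h⟩ := hu x hx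
        obtain ⟨y', hy', h'⟩ := hu' x hx
        rcases le_total (A.valuation y) (A.valuation y') with hle | hle
        · refine ⟨y', hy', ?_⟩
          rw [add_mul]
          exact A.valuation.map_add_le (h.trans hle) h'
        · refine ⟨y, hy, ?_⟩
          rw [add_mul]
          exact A.valuation.map_add_le h (h'.trans hle)
      mul_mem' := by
        intro u u' hu hu' x hx
        obtain ⟨y, hy, h⟩ := hu' x hx
        obtain ⟨z, hz, h'⟩ := hu y hy
        refine ⟨z, hz, le_trans ?_ h'⟩
        rw [mul_assoc, map_mul, map_mul A.valuation u y]
        exact mul_le_mul_right h _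
      neg_mem' := by
        intro u hu x hx
        obtain ⟨y, hy, h⟩ := hu x hx
        exact ⟨y, hy, by rwa [neg_mul, Valuation.map_neg]⟩ }
  have hS : ∀ u, u ∈ S ↔ ∀ x ∈ I, ∃ y ∈ I, A.valuation (u * x) ≤ A.valuation y :=
    fun u => Iff.rfl
  have hAS : A.toSubring ≤ S := by
    intro u hu x hx
    refine ⟨x, hx, ?_⟩
    rw [map_mul]
    exact mul_le_of_le_one_left' ((A.valuation_le_one_iff _).2 hu)
  set U := ValuationSubring.ofLE A S hAS with hU
  have hUmem : ∀ u, u ∈ U ↔ ∀ x ∈ I, ∃ y ∈ I, A.valuation (u * x) ≤ A.valuation y :=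
    fun u => Iff.rfl
  have hAU : A ≤ U := fun u hu => hAS hu
  by_cases hex : ∃ a ∈ I, a ≠ 0 ∧ ∀ x ∈ I, x / a ∈ U
  · obtain ⟨a, ha, ha0, h⟩ := hex
    exact ⟨a, ha, ha0, U, hAU, h, fun u hu => (hUmem u).1 hu a ha⟩
  exfalso
  push Not at hex
  obtain ⟨a, ha, ha0⟩ := Submodule.exists_mem_ne_zero_of_ne_bot hI
  obtain ⟨x, -, hx⟩ := hex a ha ha0
  obtain ⟨π, hπ0, hπ1, hππ⟩ := hπ U hAU ⟨_, hx⟩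
  have hπU : π⁻¹ ∉ U := by
    rw [← U.valuation_le_one_iff, map_inv₀, not_le]
    exact (one_lt_inv₀ (zero_lt_iff.2 ((Valuation.ne_zero_iff _).2 hπ0))).2 hπ1
  rw [hUmem] at hπU
  push Not at hπU
  obtain ⟨x0, hx0, hlt⟩ := hπU
  have hx00 : x0 ≠ 0 := by
    rintro rfl
    simpa using hlt 0 I.zero_mem
  have step : ∀ y ∈ I, y ≠ 0 → ∃ z ∈ I, z ≠ 0 ∧ U.valuation (y / z) < 1 := by
    intro y hy hy0
    obtain ⟨z, hz, hzy⟩ := hex y hy hy0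
    have hz0 : z ≠ 0 := by
      rintro rfl
      exact hzy (by simp)
    refine ⟨z, hz, hz0, ?_⟩
    rw [← U.valuation_le_one_iff, not_le] at hzy
    have := inv_lt_one_of_one_lt₀ hzy
    rwa [← map_inv₀, inv_div] at this
  obtain ⟨x1, hx1, hx10, h01⟩ := step x0 hx0 hx00
  obtain ⟨x2, hx2, hx20, h12⟩ := step x1 hx1 hx10
  have h := hππ _ _ h01 h12
  rw [ValuationSubring.valuation_le_valuation_iff hπ0] at h
  obtain ⟨y, hy, hle⟩ := (hUmem _).1 h x2 hx2
  refine (hlt y hy).not_ge ?_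
  convert hle using 2
  field_simp

end Estimates

section Overrings

variable {R K : Type*} [CommRing R] [IsDomain R] [IsLocalRing R] [Field K] [Algebra R K]
  [IsFractionRing R K]

local notation "φ" => algebraMap R K

omit [IsLocalRing R] in
theorem IsValuationDomain.mem_or_inv_mem {P : Ideal R} (h : IsValuationDomain (locAlg R K P))
    (z : K) : z ∈ locAlg R K P ∨ z⁻¹ ∈ locAlg R K P := by
  obtain ⟨a, b, hb, rfl⟩ := IsFractionRing.div_surjective (A := R) z
  have hb0 : φ b ≠ 0 := by
    rw [Ne, IsFractionRing.to_map_eq_zero_iff]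
    exact nonZeroDivisors.ne_zero hb
  by_cases ha0 : φ a = 0
  · left
    rw [ha0, zero_div]
    exact zero_mem _
  rcases h (algebraMap R _ a) (algebraMap R _ b) with ⟨c, hc⟩ | ⟨c, hc⟩
  · right
    have hc' : φ b = φ a * c := congrArg Subtype.val hc
    have : (φ a / φ b)⁻¹ = c := by
      rw [inv_div, hc']
      field_simp
    rw [this]
    exact c.2
  · left
    have hc' : φ a = φ b * c := congrArg Subtype.val hc
    have : φ a / φ b = c := by
      rw [hc']
      field_simp
    rw [this]
    exact c.2

theorem exists_pow_mul_eq_algebraMap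
    (hfs : ∀ I : Submodule R K, I ≠ ⊥ → I.FG → IsStableIdeal R K I)
    (hval : ∀ P : Ideal R, P.IsPrime → P ≠ ⊥ → P ≠ IsLocalRing.maximalIdeal R →
      IsValuationDomain (locAlg R K P)) {e : K} (he : IsIntegral R e) {m : R}
    (hm : m ∈ IsLocalRing.maximalIdeal R) : ∃ (N : ℕ) (r : R), φ m ^ N * e = φ r := by
  let C : Ideal R :=
    { carrier := {r | ∃ s : R, φ r * e = φ s}
      zero_mem' := ⟨0, by simp⟩
      add_mem' := by
        rintro a b ⟨s, hs⟩ ⟨s', hs'⟩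
        exact ⟨s + s', by rw [map_add, add_mul, hs, hs', map_add]⟩
      smul_mem' := by
        rintro c a ⟨s, hs⟩
        exact ⟨c * s, by rw [smul_eq_mul, map_mul, mul_assoc, hs, map_mul]⟩ }
  have hC : ∀ r, r ∈ C ↔ ∃ s : R, φ r * e = φ s := fun r => Iff.rfl
  suffices h : ∃ N : ℕ, m ^ N ∈ C by
    obtain ⟨N, hN⟩ := h
    obtain ⟨s, hs⟩ := (hC _).1 hN
    exact ⟨N, s, by rw [← map_pow, hs]⟩
  by_contra! hN
  have hdisj : Disjoint (C : Set R) (Submonoid.powers m) := by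
    rw [Set.disjoint_left]
    rintro x hx ⟨N, rfl⟩
    exact hN N hx
  obtain ⟨P, hP, hCP, hPm⟩ := Ideal.exists_le_prime_disjoint C (Submonoid.powers m) hdisj
  have hmP : m ∉ P := fun h => Set.disjoint_left.1 hPm h ⟨1, by simp⟩
  have hPM : P ≠ IsLocalRing.maximalIdeal R := fun h => hmP (h ▸ hm)
  have hP0 : P ≠ ⊥ := by
    obtain ⟨a, b, hb, hab⟩ := IsFractionRing.div_surjective (A := R) e
    have hb0 : b ≠ 0 := nonZeroDivisors.ne_zero hb
    have hb0' : φ b ≠ 0 := by rwa [Ne, IsFractionRing.to_map_eq_zero_iff]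
    have hbC : b ∈ C := (hC _).2 ⟨a, by rw [← hab]; field_simp⟩
    intro h
    have := hCP hbC
    rw [h, Ideal.mem_bot] at this
    exact hb0 this
  have heV : e ∈ locAlg R K P := by
    rcases (hval P hP hP0 hPM).mem_or_inv_mem e with h | h
    · exact h
    by_cases he0 : e = 0
    · rw [he0]
      exact zero_mem _
    obtain ⟨a, b, hab⟩ := exists_sq_eq_of_isIntegral hfs he
    have : e = φ a + φ b * e⁻¹ := by
      field_simp
      linear_combination hab
    rw [this]
    exact add_mem (algebraMap_mem _ _) (mul_mem (algebraMap_mem _ _) h)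
  obtain ⟨r, s, hs, hrs⟩ := (mem_locAlg_iff hP).1 heV
  have hs0 : φ s ≠ 0 := algebraMap_ne_zero_of_notMem hs
  exact hs (hCP ((hC _).2 ⟨r, by rw [hrs]; field_simp⟩))

theorem ValuationSubring.exists_forall_mul_le
    (hfs : ∀ I : Submodule R K, I ≠ ⊥ → I.FG → IsStableIdeal R K I)
    (hval : ∀ P : Ideal R, P.IsPrime → P ≠ ⊥ → P ≠ IsLocalRing.maximalIdeal R →
      IsValuationDomain (locAlg R K P) ∧ StronglyDiscrete (locAlg R K P))
    {A : ValuationSubring K} (hd : A.valuation.DominatesIntegral R) {m : R}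
    (hmM : m ∈ IsLocalRing.maximalIdeal R) (hm0 : φ m ≠ 0)
    (hm : ∀ x ∈ IsLocalRing.maximalIdeal R, A.valuation (φ x) ≤ A.valuation (φ m))
    {U : ValuationSubring K} (hAU : A ≤ U) (hU : ∃ x, x ∉ U) :
    ∃ π : K, π ≠ 0 ∧ U.valuation π < 1 ∧ ∀ q q', U.valuation q < 1 → U.valuation q' < 1 →
      U.valuation (q * q') ≤ U.valuation π := by
  by_cases hUA : U ≤ A
  · obtain rfl : A = U := le_antisymm hAU hUA
    refine ⟨φ m, hm0, hd.lt_one_of_mem m hmM, fun q q' hq hq' => ?_⟩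
    rcases le_total (A.valuation q) (A.valuation q') with h | h
    · refine le_trans ?_ (hd.map_mul_self_le hfs hm hq')
      rw [map_mul, map_mul]
      exact mul_le_mul_left h _
    · refine le_trans ?_ (hd.map_mul_self_le hfs hm hq)
      rw [map_mul, map_mul]
      exact mul_le_mul_right h _
  obtain ⟨u, hu, huA⟩ := SetLike.not_le_iff_exists.1 hUA
  have hmU := ValuationSubring.inv_mem_of_notMem hAU hd hfs hm0 hm hu huA
  set w := U.valuation with hw
  have hRU : ∀ r : R, w (φ r) ≤ 1 := fun r =>
    (U.valuation_le_one_iff _).2 (hAU ((A.valuation_le_one_iff _).1 (hd.map_le_one r)))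
  let P : Ideal R :=
    { carrier := {r | w (φ r) < 1}
      zero_mem' := by simp
      add_mem' := by
        intro a b ha hb
        change w (φ (a + b)) < 1
        rw [map_add]
        exact w.map_add_lt ha hb
      smul_mem' := by
        intro c a ha
        change w (φ (c * a)) < 1
        rw [map_mul]
        exact w.mul_lt_one_of_le_of_lt (hRU c) ha }
  have hPmem : ∀ r, r ∈ P ↔ w (φ r) < 1 := fun r => Iff.rfl
  have hPnot : ∀ r, r ∉ P → w (φ r) = 1 := fun r hr =>
    le_antisymm (hRU r) (not_lt.1 hr)
  have hP : P.IsPrime := by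
    refine ⟨fun h => ?_, fun {x y} hxy => ?_⟩
    · have := (hPmem 1).1 ((Ideal.eq_top_iff_one _).1 h)
      simp at this
    · by_contra! h
      have := (hPmem _).1 hxy
      rw [map_mul, map_mul, hPnot x h.1, hPnot y h.2, mul_one] at this
      exact lt_irrefl _ this
  have hP0 : P ≠ ⊥ := by
    obtain ⟨x, hx⟩ := hU
    obtain ⟨a, b, hb, rfl⟩ := IsFractionRing.div_surjective (A := R) x
    have hb0 : b ≠ 0 := nonZeroDivisors.ne_zero hb
    have hbP : b ∈ P := by
      by_contra hbP
      refine hx ((U.valuation_le_one_iff _).1 ?_)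
      rw [map_div₀, ← hw, hPnot b hbP, div_one]
      exact hRU a
    intro h
    rw [h, Ideal.mem_bot] at hbP
    exact hb0 hbP
  have hPM : P ≠ IsLocalRing.maximalIdeal R := by
    intro h
    have h1 := (hPmem m).1 (h ▸ hmM)
    have h2 := w.mul_lt_one_of_le_of_lt ((U.valuation_le_one_iff _).2 hmU) h1
    rw [inv_mul_cancel₀ hm0, map_one] at h2
    exact lt_irrefl _ h2
  obtain ⟨hV, hsd⟩ := hval P hP hP0 hPM
  have hVU : ∀ z ∈ locAlg R K P, w z ≤ 1 := by
    intro z hz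
    obtain ⟨r, s, hs, rfl⟩ := (mem_locAlg_iff hP).1 hz
    rw [map_div₀, hPnot s hs, div_one]
    exact hRU r
  have hUV : ∀ z, w z ≤ 1 → z ∈ locAlg R K P := by
    intro z hz
    by_cases hz0 : z = 0
    · rw [hz0]
      exact ZeroMemClass.zero_mem _
    rcases hV.mem_or_inv_mem z with h | h
    · exact h
    obtain ⟨r, s, hs, hrs⟩ := (mem_locAlg_iff hP).1 h
    have hr : r ∉ P := by
      intro hr
      have h1 := (hPmem r).1 hr
      have h2 : w z⁻¹ < 1 := by rwa [hrs, map_div₀, hPnot s hs, div_one]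
      have h3 := w.mul_lt_one_of_le_of_lt hz h2
      rw [mul_inv_cancel₀ hz0, map_one] at h3
      exact lt_irrefl _ h3
    exact (mem_locAlg_iff hP).2 ⟨s, r, hr, by rw [← inv_inv z, hrs, inv_div]⟩
  let Q : Ideal (locAlg R K P) :=
    { carrier := {x | w (x : K) < 1}
      zero_mem' := by simp
      add_mem' := fun {a b} ha hb => w.map_add_lt ha hb
      smul_mem' := fun c a ha => w.mul_lt_one_of_le_of_lt (hVU c c.2) ha }
  have hQmem : ∀ x, x ∈ Q ↔ w (x : K) < 1 := fun x => Iff.rfl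
  have hQ : Q.IsPrime := by
    refine ⟨fun h => ?_, fun {x y} hxy => ?_⟩
    · have := (hQmem 1).1 ((Ideal.eq_top_iff_one _).1 h)
      simp at this
    · by_contra! h
      have hx : w (x : K) = 1 := le_antisymm (hVU x x.2) (not_lt.1 h.1)
      have hy : w (y : K) = 1 := le_antisymm (hVU y y.2) (not_lt.1 h.2)
      have := (hQmem _).1 hxy
      rw [MulMemClass.coe_mul, map_mul, hx, hy, mul_one] at this
      exact lt_irrefl _ this
  have hQ0 : Q ≠ ⊥ := by
    obtain ⟨p, hp, hp0⟩ := Submodule.exists_mem_ne_zero_of_ne_bot hP0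
    intro h
    have hpQ : algebraMap R (locAlg R K P) p ∈ Q := (hPmem p).1 hp
    rw [h, Ideal.mem_bot] at hpQ
    have : φ p = 0 := congrArg Subtype.val hpQ
    rw [IsFractionRing.to_map_eq_zero_iff] at this
    exact hp0 this
  obtain ⟨π, hπ, hπQ⟩ : ∃ π ∈ Q, π ∉ Q * Q := by
    by_contra! h
    exact hsd Q hQ hQ0 (le_antisymm Ideal.mul_le_left h)
  have hπ0 : (π : K) ≠ 0 := by
    intro h
    have : π = 0 := Subtype.ext h
    exact hπQ (this ▸ (Q * Q).zero_mem)
  refine ⟨π, hπ0, hπ, fun q q' hq hq' => ?_⟩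
  by_contra! hlt
  refine hπQ ?_
  have hqq0 : q * q' ≠ 0 := by
    intro h
    rw [h, map_zero] at hlt
    exact not_lt_zero hlt
  have hq0 := left_ne_zero_of_mul hqq0
  have hq0' := right_ne_zero_of_mul hqq0
  have hy : w (π / (q * q')) ≤ 1 :=
    (U.valuation_le_one_iff _).2 ((ValuationSubring.valuation_le_valuation_iff hqq0).1 hlt.le)
  have hq'y : w (π / (q * q') * q') < 1 := w.mul_lt_one_of_le_of_lt hy hq'
  have e : π = (⟨q, hUV q hq.le⟩ : locAlg R K P) * ⟨π / (q * q') * q', hUV _ hq'y.le⟩ := by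
    refine Subtype.ext ?_
    change (π : K) = q * (π / (q * q') * q')
    field_simp
  rw [e]
  exact Ideal.mul_mem_mul hq hq'y

end Overrings

section Stability

variable {R K : Type*} [CommRing R] [IsDomain R] [IsLocalRing R] [Field K] [Algebra R K]
  [IsFractionRing R K]

local notation "φ" => algebraMap R K

/-- Two valuation rings which dominate `R`, meet in the integral closure of `R`, and are either
equal or separated by integral elements. -/
structure DominatingPair (R : Type*) {K : Type*} [CommRing R] [IsLocalRing R] [Field K]
    [Algebra R K] (A₁ A₂ : ValuationSubring K) : Prop where
  left : A₁.valuation.DominatesIntegral R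
  right : A₂.valuation.DominatesIntegral R
  isIntegral : ∀ x, x ∈ A₁ → x ∈ A₂ → IsIntegral R x
  eq_or_separated : A₁ = A₂ ∨
    (∃ t, IsIntegral R t ∧ A₁.valuation t = 1 ∧ A₂.valuation t < 1) ∧
      (∃ t, IsIntegral R t ∧ A₂.valuation t = 1 ∧ A₁.valuation t < 1)

omit [IsDomain R] [IsFractionRing R K] in
theorem DominatingPair.symm {A₁ A₂ : ValuationSubring K} (h : DominatingPair R A₁ A₂) :
    DominatingPair R A₂ A₁ :=
  ⟨h.right, h.left, fun x h₁ h₂ => h.isIntegral x h₂ h₁,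
    h.eq_or_separated.imp Eq.symm And.symm⟩

omit [IsDomain R] [IsFractionRing R K] in
theorem DominatingPair.isIntegral_div {A₁ A₂ : ValuationSubring K} (h : DominatingPair R A₁ A₂)
    {x y : K} (hy : y ≠ 0) (h₁ : A₁.valuation x ≤ A₁.valuation y)
    (h₂ : A₂.valuation x ≤ A₂.valuation y) : IsIntegral R (x / y) :=
  h.isIntegral _ ((ValuationSubring.valuation_le_valuation_iff hy).1 h₁)
    ((ValuationSubring.valuation_le_valuation_iff hy).1 h₂)

variable {A₁ A₂ : ValuationSubring K}

theorem DominatingPair.exists_mul_eq_add_mul (hA : DominatingPair R A₁ A₂)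
    (hfs : ∀ I : Submodule R K, I ≠ ⊥ → I.FG → IsStableIdeal R K I)
    (hval : ∀ P : Ideal R, P.IsPrime → P ≠ ⊥ → P ≠ IsLocalRing.maximalIdeal R →
      IsValuationDomain (locAlg R K P)) {m : R}
    (hmM : m ∈ IsLocalRing.maximalIdeal R) (hm0 : φ m ≠ 0)
    (hm₁ : ∀ x ∈ IsLocalRing.maximalIdeal R, A₁.valuation (φ x) ≤ A₁.valuation (φ m))
    (hm₂ : ∀ x ∈ IsLocalRing.maximalIdeal R, A₂.valuation (φ x) ≤ A₂.valuation (φ m))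
    {e : K} (he : IsIntegral R e) {U : ValuationSubring K} (hAU : A₁ ≤ U) (hUA : ¬ U ≤ A₁) :
    ∃ π : K, π ≠ 0 ∧ IsIntegral R π ∧ π⁻¹ ∈ U ∧
      ∀ h, IsIntegral R h → A₁.valuation h ≤ A₁.valuation π → ∃ r s : R, e * h = φ r + φ s * h := by
  obtain ⟨u, hu, huA⟩ := SetLike.not_le_iff_exists.1 hUA
  have hmU := ValuationSubring.inv_mem_of_notMem hAU hA.left hfs hm0 hm₁ hu huA
  have hπU : ∀ N : ℕ, (φ m ^ N)⁻¹ ∈ U := fun N => by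
    rw [← inv_pow]
    exact pow_mem hmU N
  rcases hA.eq_or_separated with rfl | ⟨⟨t, hti, ht₁, ht₂⟩, -⟩
  · obtain ⟨N, ρ, hN⟩ := exists_pow_mul_eq_algebraMap hfs hval he hmM
    have hπ0 : φ m ^ N ≠ 0 := pow_ne_zero _ hm0
    refine ⟨φ m ^ N, hπ0, isIntegral_algebraMap.pow _, hπU N, fun h hh hle => ?_⟩
    have hint := hA.isIntegral_div hπ0 hle hle
    obtain ⟨α, β, γ, heq⟩ := exists_mul_eq_of_isIntegral hfs he hint
    refine ⟨m ^ N * α + β * ρ, γ, ?_⟩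
    have hh' : h = φ m ^ N * (h / φ m ^ N) := by field_simp
    simp only [map_add, map_mul, map_pow]
    rw [← hN]
    calc e * h = φ m ^ N * (e * (h / φ m ^ N)) := by
          conv_lhs => rw [hh']
          ring
      _ = φ m ^ N * φ α + φ β * (φ m ^ N * e) + φ γ * (φ m ^ N * (h / φ m ^ N)) := by
          rw [heq]; ring
      _ = _ := by rw [← hh']
  · obtain ⟨N, ρ, hN⟩ := exists_pow_mul_eq_algebraMap hfs hval hti hmM
    have hπ0 : φ m ^ (N + 1) ≠ 0 := pow_ne_zero _ hm0
    have hR : ∀ y, IsIntegral R y → ∃ r : R, φ m ^ (N + 1) * y = φ r := by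
      intro y hy
      obtain ⟨c, d, rfl⟩ := exists_eq_add_mul_of_separated hfs hA.left hA.right hti ht₁ ht₂ hy
      refine ⟨m ^ (N + 1) * c + m * d * ρ, ?_⟩
      simp only [map_add, map_mul, map_pow, ← hN]
      ring
    obtain ⟨s, hs⟩ : ∃ s, s = (t * t) ^ (N + 1) := ⟨_, rfl⟩
    have hsi : IsIntegral R s := hs ▸ (hti.mul hti).pow _
    have hs₁ : A₁.valuation s = 1 := by rw [hs, map_pow, map_mul, ht₁, mul_one, one_pow]
    have hs₂ : A₂.valuation s < 1 := by
      have htt : A₂.valuation (t * t) < 1 := A₂.valuation.mul_lt_one_of_le_of_lt ht₂.le ht₂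
      rw [hs, map_pow]
      exact pow_lt_one₀ zero_le htt (Nat.succ_ne_zero N)
    have hs₂' : A₂.valuation s ≤ A₂.valuation (φ m ^ (N + 1)) := by
      rw [hs, map_pow, map_pow]
      exact pow_le_pow_left₀ zero_le (hA.right.map_mul_self_le hfs hm₂ ht₂) _
    obtain ⟨r₀, s₀, hrs⟩ := exists_eq_add_mul_of_separated hfs hA.left hA.right hsi hs₁ hs₂ he
    refine ⟨φ m ^ (N + 1), hπ0, isIntegral_algebraMap.pow _, hπU _, fun h hh hle => ?_⟩
    have hint : IsIntegral R (s * h / φ m ^ (N + 1)) := by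
      refine hA.isIntegral_div hπ0 ?_ ?_
      · rwa [map_mul, hs₁, one_mul]
      · rw [map_mul]
        exact (mul_le_of_le_one_right' (hA.right.le_one_of_isIntegral _ hh)).trans hs₂'
    obtain ⟨ρ', hρ'⟩ := hR _ hint
    refine ⟨s₀ * ρ', r₀, ?_⟩
    have hsh : s * h = φ ρ' := by
      rw [← hρ']
      field_simp
    rw [hrs, map_mul, ← hsh]
    ring

theorem DominatingPair.mul_mem_of_isIntegral (hA : DominatingPair R A₁ A₂)
    (hfs : ∀ I : Submodule R K, I ≠ ⊥ → I.FG → IsStableIdeal R K I)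
    (hval : ∀ P : Ideal R, P.IsPrime → P ≠ ⊥ → P ≠ IsLocalRing.maximalIdeal R →
      IsValuationDomain (locAlg R K P)) {m : R}
    (hmM : m ∈ IsLocalRing.maximalIdeal R) (hm0 : φ m ≠ 0)
    (hm₁ : ∀ x ∈ IsLocalRing.maximalIdeal R, A₁.valuation (φ x) ≤ A₁.valuation (φ m))
    (hm₂ : ∀ x ∈ IsLocalRing.maximalIdeal R, A₂.valuation (φ x) ≤ A₂.valuation (φ m))
    {U : ValuationSubring K} (hAU : A₁ ≤ U) (hUA : ¬ U ≤ A₁) {I : Submodule R K} {b : K}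
    (hb0 : b ≠ 0) (hIU : ∀ x ∈ I, x / b ∈ U)
    (hUI : ∀ u ∈ U, ∃ x ∈ I, A₁.valuation (u * b) ≤ A₁.valuation x) {e : K}
    (he : IsIntegral R e) {c : K} (hc : c ∈ I) : e * c ∈ I := by
  by_cases hc0 : c = 0
  · rw [hc0, mul_zero]
    exact I.zero_mem
  obtain ⟨π, hπ0, hπi, hπU, hπ⟩ :=
    hA.exists_mul_eq_add_mul hfs hval hmM hm0 hm₁ hm₂ he hAU hUA
  obtain ⟨x, hx, hcx⟩ := hUI _ (mul_mem hπU (hIU c hc))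
  have hcx' : A₁.valuation (c / π) ≤ A₁.valuation x := by
    convert hcx using 2
    field_simp
  obtain ⟨y, hy, h₁, h₂⟩ :=
    Submodule.exists_valuation_le_and_valuation_le A₁.valuation A₂.valuation hx hc
  have hcy₁ := hcx'.trans h₁
  have hy0 : y ≠ 0 := by
    rintro rfl
    rw [map_zero, le_zero_iff, Valuation.zero_iff] at h₂
    exact hc0 h₂
  have hcyπ : A₁.valuation (c / y) ≤ A₁.valuation π := by
    rw [ValuationSubring.valuation_le_valuation_iff hπ0]
    rw [ValuationSubring.valuation_le_valuation_iff hy0] at hcy₁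
    convert hcy₁ using 1
    field_simp
  have hcy : IsIntegral R (c / y) :=
    hA.isIntegral _ ((A₁.valuation_le_one_iff _).1
        (hcyπ.trans (hA.left.le_one_of_isIntegral _ hπi)))
      ((ValuationSubring.valuation_le_valuation_iff hy0).1 h₂)
  obtain ⟨r, s, hrs⟩ := hπ _ hcy hcyπ
  have : e * c = r • y + s • c := by
    rw [Algebra.smul_def, Algebra.smul_def]
    field_simp at hrs
    linear_combination hrs
  rw [this]
  exact I.add_mem (I.smul_mem _ hy) (I.smul_mem _ hc)

theorem isStableIdeal_of_isValuationDomain_of_stronglyDiscrete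
    (hfs : ∀ I : Submodule R K, I ≠ ⊥ → I.FG → IsStableIdeal R K I)
    (hval : ∀ P : Ideal R, P.IsPrime → P ≠ ⊥ → P ≠ IsLocalRing.maximalIdeal R →
      IsValuationDomain (locAlg R K P) ∧ StronglyDiscrete (locAlg R K P))
    (hM0 : IsLocalRing.maximalIdeal R ≠ ⊥)
    (hM : IsStableIdeal R K (idealK R K (IsLocalRing.maximalIdeal R))) {I : Submodule R K}
    (hI : I ≠ ⊥) : IsStableIdeal R K I := by
  have hval' : ∀ P : Ideal R, P.IsPrime → P ≠ ⊥ → P ≠ IsLocalRing.maximalIdeal R →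
      IsValuationDomain (locAlg R K P) := fun P hP h0 h1 => (hval P hP h0 h1).1
  obtain ⟨A₁, A₂, hd₁, hd₂, hint, hsep⟩ := exists_valuationSubring_pair (R := R) (K := K) hfs
  have hA : DominatingPair R A₁ A₂ := ⟨hd₁, hd₂, hint, hsep⟩
  obtain ⟨m, hmM, hm0, hm₁, hm₂⟩ : ∃ m ∈ IsLocalRing.maximalIdeal R, φ m ≠ 0 ∧
      (∀ x ∈ IsLocalRing.maximalIdeal R, A₁.valuation (φ x) ≤ A₁.valuation (φ m)) ∧
      (∀ x ∈ IsLocalRing.maximalIdeal R, A₂.valuation (φ x) ≤ A₂.valuation (φ m)) := by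
    obtain ⟨m₁, hm₁, h₁⟩ := exists_forall_valuation_le_of_isStableIdeal hfs hM hd₁
    obtain ⟨m₂, hm₂, h₂⟩ := exists_forall_valuation_le_of_isStableIdeal hfs hM hd₂
    obtain ⟨b, hb, hb₁, hb₂⟩ := Submodule.exists_valuation_le_and_valuation_le A₁.valuation
      A₂.valuation (mem_idealK.2 ⟨m₁, hm₁, rfl⟩) (mem_idealK.2 ⟨m₂, hm₂, rfl⟩)
    obtain ⟨m, hm, rfl⟩ := mem_idealK.1 hb
    refine ⟨m, hm, fun h0 => ?_, fun x hx => (h₁ x hx).trans hb₁, fun x hx => (h₂ x hx).trans hb₂⟩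
    obtain ⟨x, hx, hx0⟩ := Submodule.exists_mem_ne_zero_of_ne_bot hM0
    have := (h₁ x hx).trans hb₁
    rw [h0, map_zero, le_zero_iff, Valuation.zero_iff, IsFractionRing.to_map_eq_zero_iff] at this
    exact hx0 this
  obtain ⟨a₁, ha₁, ha₁0, U₁, hAU₁, hIU₁, hUI₁⟩ :=
    Submodule.exists_valuationSubring_of_forall_overring (A := A₁) (fun U hAU hU =>
      ValuationSubring.exists_forall_mul_le hfs hval hd₁ hmM hm0 hm₁ hAU hU) hI
  obtain ⟨a₂, ha₂, ha₂0, U₂, hAU₂, hIU₂, hUI₂⟩ :=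
    Submodule.exists_valuationSubring_of_forall_overring (A := A₂) (fun U hAU hU =>
      ValuationSubring.exists_forall_mul_le hfs hval hd₂ hmM hm0 hm₂ hAU hU) hI
  obtain ⟨b, hb, hab₁, hab₂⟩ :=
    Submodule.exists_valuation_le_and_valuation_le A₁.valuation A₂.valuation ha₁ ha₂
  have hb0 : b ≠ 0 := by
    rintro rfl
    rw [map_zero, le_zero_iff, Valuation.zero_iff] at hab₁
    exact ha₁0 hab₁
  have hchange : ∀ {A U : ValuationSubring K} {a : K}, A ≤ U → a ≠ 0 → (∀ x ∈ I, x / a ∈ U) →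
      (∀ u ∈ U, ∃ x ∈ I, A.valuation (u * a) ≤ A.valuation x) →
      A.valuation a ≤ A.valuation b →
      (∀ x ∈ I, x / b ∈ U) ∧ ∀ u ∈ U, ∃ x ∈ I, A.valuation (u * b) ≤ A.valuation x := by
    intro A U a hAU ha0 hIU hUI hab
    rw [ValuationSubring.valuation_le_valuation_iff hb0] at hab
    refine ⟨fun x hx => ?_, fun u hu => ?_⟩
    · have := mul_mem (hIU x hx) (hAU hab)
      rwa [div_mul_div_cancel₀ ha0] at this
    · obtain ⟨x, hx, h⟩ := hUI _ (mul_mem hu (hIU b hb))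
      refine ⟨x, hx, ?_⟩
      rwa [mul_assoc, div_mul_cancel₀ _ ha0] at h
  obtain ⟨hIU₁, hUI₁⟩ := hchange hAU₁ ha₁0 hIU₁ hUI₁ hab₁
  obtain ⟨hIU₂, hUI₂⟩ := hchange hAU₂ ha₂0 hIU₂ hUI₂ hab₂
  refine isStableIdeal_of_mul_mem hb hb0 fun x hx y hy => ?_
  by_cases hU : U₁ ≤ A₁ ∧ U₂ ≤ A₂
  · have hdiv : ∀ x ∈ I, IsIntegral R (x / b) := fun x hx =>
      hint _ (hU.1 (hIU₁ x hx)) (hU.2 (hIU₂ x hx))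
    obtain ⟨p, q, r, h⟩ := exists_mul_eq_of_isIntegral hfs (hdiv x hx) (hdiv y hy)
    have : x * y * b⁻¹ = p • b + q • x + r • y := by
      simp only [Algebra.smul_def]
      field_simp at h ⊢
      linear_combination h
    rw [this]
    exact I.add_mem (I.add_mem (I.smul_mem _ hb) (I.smul_mem _ hx)) (I.smul_mem _ hy)
  have hmul : ∀ e, IsIntegral R e → ∀ c ∈ I, e * c ∈ I := by
    intro e he c hc
    rw [not_and_or] at hU
    rcases hU with hU | hU
    · exact hA.mul_mem_of_isIntegral hfs hval' hmM hm0 hm₁ hm₂ hAU₁ hU hb0 hIU₁ hUI₁ he hc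
    · exact hA.symm.mul_mem_of_isIntegral hfs hval' hmM hm0 hm₂ hm₁ hAU₂ hU hb0 hIU₂ hUI₂ he hc
  obtain ⟨x₁, hx₁, h₁⟩ := hUI₁ _ (mul_mem (hIU₁ x hx) (hIU₁ y hy))
  obtain ⟨x₂, hx₂, h₂⟩ := hUI₂ _ (mul_mem (hIU₂ x hx) (hIU₂ y hy))
  obtain ⟨z, hz, hz₁, hz₂⟩ :=
    Submodule.exists_valuation_le_and_valuation_le A₁.valuation A₂.valuation hx₁ hx₂
  have e : x / b * (y / b) * b = x * y * b⁻¹ := by field_simp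
  rw [e] at h₁ h₂
  by_cases hz0 : z = 0
  · have := h₁.trans hz₁
    rw [hz0, map_zero, le_zero_iff, Valuation.zero_iff] at this
    rw [this]
    exact I.zero_mem
  · have := hmul _ (hA.isIntegral_div hz0 (h₁.trans hz₁) (h₂.trans hz₂)) z hz
    rwa [div_mul_cancel₀ _ hz0] at this

end Stability

/-- Let `(R, M)` be a local domain with nonzero maximal ideal `M` which is
finitely stable. Then `R` is stable if and only if `R_P` is a strongly discrete valuation
domain for each nonzero prime `P ≠ M` and `M` is a stable ideal of `R`. -/
theorem local_finitely_stable_is_stable_iff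
    {R K : Type*} [CommRing R] [IsDomain R] [Field K] [Algebra R K] [IsFractionRing R K]
    (M : Ideal R) (hM : M.IsMaximal) (hM0 : M ≠ ⊥)
    (hlocal : ∀ N : Ideal R, N.IsMaximal → N = M)
    (hfs : ∀ I : Submodule R K, I ≠ ⊥ → I.FG → IsStableIdeal R K I) :
    StableDomain R K ↔
      ((∀ P : Ideal R, P.IsPrime → P ≠ ⊥ → P ≠ M →
          IsValuationDomain (locAlg R K P) ∧ StronglyDiscrete (locAlg R K P)) ∧
        IsStableIdeal R K (idealK R K M)) := by
  have : IsLocalRing R := IsLocalRing.of_unique_max_ideal ⟨M, hM, hlocal⟩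
  obtain rfl : IsLocalRing.maximalIdeal R = M := hlocal _ (IsLocalRing.maximalIdeal.isMaximal R)
  refine ⟨fun hst => ⟨fun P hP hP0 hPM => ⟨hst.isValuationDomain_locAlg hfs hP hP0 hPM,
    hst.stronglyDiscrete_locAlg hP⟩, hst _ ⟨?_, 1, one_ne_zero, ?_⟩⟩,
    fun ⟨hval, hst⟩ I hI =>
      isStableIdeal_of_isValuationDomain_of_stronglyDiscrete hfs hval hM0 hst hI.1⟩
  · obtain ⟨x, hx, hx0⟩ := Submodule.exists_mem_ne_zero_of_ne_bot hM0
    refine (Submodule.ne_bot_iff _).2 ⟨algebraMap R K x, mem_idealK.2 ⟨x, hx, rfl⟩, ?_⟩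
    rwa [Ne, IsFractionRing.to_map_eq_zero_iff]
  · intro x hx
    obtain ⟨a, -, rfl⟩ := mem_idealK.1 hx
    exact ⟨a, by rw [map_one, one_mul]⟩
end

section
/- Let (R, M) be a local one-dimensional integral domain (M is the unique maximal ideal, M ≠ 0, and every nonzero prime ideal of R equals M) and set E := (M : M). Then the following are equivalent: (i) R is stable; (ii) R is Clifford regular and M is a stable ideal of R; (iii) R is Clifford regular and every maximal ideal N of the ring E is divisorial as an ideal of E, i.e. N = (E : (E : N)). -/
open scoped Pointwise

/-- The endomorphism ring `E := (I : I) = {x ∈ K : xI ⊆ I}` of a (nonzero) ideal, as a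
subring of `K` containing `R`. -/
def endAlg (R K : Type*) [CommRing R] [Field K] [Algebra R K] (I : Submodule R K) :
    Subalgebra R K where
  carrier := (I / I : Submodule R K)
  mul_mem' {a b} ha hb := by
    rw [SetLike.mem_coe, Submodule.mem_div_iff_forall_mul_mem] at *
    intro y hy
    rw [mul_assoc]
    exact ha _ (hb y hy)
  one_mem' := by
    rw [SetLike.mem_coe, Submodule.mem_div_iff_forall_mul_mem]
    intro y hy
    simpa using hy
  add_mem' {a b} ha hb := by
    exact Submodule.add_mem _ ha hb
  zero_mem' := Submodule.zero_mem _
  algebraMap_mem' r := by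
    rw [SetLike.mem_coe, Submodule.mem_div_iff_forall_mul_mem]
    intro y hy
    rw [← Algebra.smul_def]
    exact Submodule.smul_mem _ _ hy

/-- If `I = I²X`, then `I` is fixed by its trace ideal `I((I:I):I)`. -/
theorem mul_trace_eq {R K : Type*} [CommRing R] [Field K] [Algebra R K] {I X : Submodule R K}
    (h : I = I * I * X) : I * (I * (I / I / I)) = I := by
  apply le_antisymm
  · calc I * (I * (I / I / I)) = I / I / I * I * I := by ring
      _ ≤ I / I * I := mul_le_mul' (Submodule.le_div_iff_mul_le.mp le_rfl) le_rfl
      _ ≤ I := Submodule.le_div_iff_mul_le.mp le_rfl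
  · have hX : X ≤ I / I / I := by
      rw [Submodule.le_div_iff_mul_le, Submodule.le_div_iff_mul_le]
      exact (show X * I * I = I by rw [mul_assoc, mul_comm, ← h]).le
    calc I = I * (I * X) := by rw [← mul_assoc, ← h]
      _ ≤ I * (I * (I / I / I)) := mul_le_mul' le_rfl (mul_le_mul' le_rfl hX)

theorem trace_mul_self {R K : Type*} [CommRing R] [Field K] [Algebra R K] {I X : Submodule R K}
    (h : I = I * I * X) :
    I * (I / I / I) * (I * (I / I / I)) = I * (I / I / I) := by
  calc I * (I / I / I) * (I * (I / I / I)) = I * (I * (I / I / I)) * (I / I / I) := by ring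
    _ = I * (I / I / I) := by rw [mul_trace_eq h]

theorem div_self_mul_self_eq {R K : Type*} [CommRing R] [Field K] [Algebra R K]
    (I : Submodule R K) : I / I * I = I := by
  apply le_antisymm (Submodule.le_div_iff_mul_le.mp le_rfl)
  nth_rw 1 [← one_mul I]
  exact mul_le_mul' (Submodule.one_le.mpr (Submodule.one_mem_div.mpr le_rfl)) le_rfl

theorem trace_le {R K : Type*} [CommRing R] [Field K] [Algebra R K]
    (I : Submodule R K) : I * (I / I / I) ≤ I / I := by
  rw [mul_comm]
  exact Submodule.le_div_iff_mul_le.mp le_rfl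

theorem isStableIdeal_of_one_mem {R K : Type*} [CommRing R] [Field K] [Algebra R K]
    {I : Submodule R K} (h : 1 ∈ I * (I / I / I)) : IsStableIdeal R K I := by
  apply le_antisymm (trace_le I)
  calc I / I = I / I * 1 := (mul_one _).symm
    _ ≤ I / I * (I * (I / I / I)) := mul_le_mul' le_rfl (Submodule.one_le.mpr h)
    _ = I * (I / I / I) := by rw [← mul_assoc, div_self_mul_self_eq]

/-- The trace ideal `I((I:I):I)` as an ideal of `(I:I)`. -/
def traceIdeal {R K : Type*} [CommRing R] [Field K] [Algebra R K] (I : Submodule R K) :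
    Ideal (endAlg R K I) where
  carrier := {x | (x : K) ∈ I * (I / I / I)}
  add_mem' ha hb := Set.mem_ofPred.mpr (add_mem (Set.mem_ofPred.mp ha) (Set.mem_ofPred.mp hb))
  zero_mem' := Set.mem_ofPred.mpr (zero_mem (I * (I / I / I)))
  smul_mem' c x hx := by
    have := Submodule.mul_mem_mul (show (c : K) ∈ I / I from c.2) (Set.mem_ofPred.mp hx)
    rw [← mul_assoc, div_self_mul_self_eq] at this
    exact Set.mem_ofPred.mpr this

theorem mem_traceIdeal {R K : Type*} [CommRing R] [Field K] [Algebra R K] {I : Submodule R K}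
    {x : endAlg R K I} : x ∈ traceIdeal I ↔ (x : K) ∈ I * (I / I / I) := Set.mem_ofPred

theorem traceIdeal_ne_top {R K : Type*} [CommRing R] [Field K] [Algebra R K]
    {I : Submodule R K} (h : 1 ∉ I * (I / I / I)) : traceIdeal I ≠ ⊤ :=
  fun htop => h (mem_traceIdeal.mp ((Ideal.eq_top_iff_one _).mp htop))

theorem StableDomain.cliffordRegularDomain {R K : Type*} [CommRing R] [Field K] [Algebra R K]
    (h : StableDomain R K) : CliffordRegularDomain R K := by
  intro I hI
  have hs : I * (I / I / I) = I / I := h I hI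
  have heq : I = I * I * (I / I / I) := by rw [mul_assoc, hs, mul_comm, div_self_mul_self_eq]
  refine ⟨I / I / I, fun h0 => hI.1 ?_, heq⟩
  rw [heq, h0, Submodule.mul_bot]

theorem algebraMap_mem_idealK {A K : Type*} [CommRing A] [Field K] [Algebra A K] {I : Ideal A}
    {a : A} (h : a ∈ I) : algebraMap A K a ∈ idealK A K I := ⟨a, h, rfl⟩

theorem isFrac_idealK {A K : Type*} [CommRing A] [IsDomain A] [Field K] [Algebra A K]
    [IsFractionRing A K] {I : Ideal A} (h : I ≠ ⊥) : IsFrac A K (idealK A K I) := by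
  obtain ⟨m, hm, hm0⟩ := Submodule.exists_mem_ne_zero_of_ne_bot h
  refine ⟨fun hb => hm0 ?_, 1, one_ne_zero, ?_⟩
  · have := algebraMap_mem_idealK (K := K) hm
    rw [hb, Submodule.mem_bot] at this
    exact (map_eq_zero_iff _ (IsFractionRing.injective A K)).mp this
  · rintro _ ⟨a, -, rfl⟩
    exact ⟨a, by simp⟩

theorem idealK_pow {A K : Type*} [CommRing A] [Field K] [Algebra A K] (I : Ideal A) (n : ℕ) :
    idealK A K (I ^ n) = idealK A K I ^ n :=
  Submodule.map_pow I (Algebra.ofId A K) n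

theorem isStableIdeal_of_forall_maximal_divisorial {R K : Type*} [CommRing R] [Field K]
    [Algebra R K] {I X : Submodule R K} (h : I = I * I * X)
    (hdiv : ∀ N : Ideal (endAlg R K I), N.IsMaximal →
      vS (endAlg R K I) K (idealK (endAlg R K I) K N) = idealK (endAlg R K I) K N) :
    IsStableIdeal R K I := by
  by_contra hst
  obtain ⟨N, hN, hle⟩ := Ideal.exists_le_maximal _
    (traceIdeal_ne_top fun h1 => hst (isStableIdeal_of_one_mem h1))
  have hone : (1 : K) ∈ vS (endAlg R K I) K (idealK (endAlg R K I) K N) := by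
    refine Submodule.one_mem_div.mpr fun x hx => ?_
    rw [Submodule.mem_div_iff_forall_mul_mem] at hx
    have hxH : Submodule.span R {x} * (I * (I / I / I)) ≤ I / I := by
      rw [Submodule.mul_le]
      intro y hy z hz
      obtain ⟨r, rfl⟩ := Submodule.mem_span_singleton.mp hy
      rw [smul_mul_assoc]
      obtain ⟨e, he⟩ := Submodule.mem_one.mp
        (hx z ⟨⟨z, trace_le I hz⟩, hle (mem_traceIdeal.mpr hz), rfl⟩)
      rw [← he]
      exact Submodule.smul_mem _ _ e.2
    have hxH' : Submodule.span R {x} * (I * (I / I / I)) ≤ I * (I / I / I) := by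
      calc Submodule.span R {x} * (I * (I / I / I))
          = Submodule.span R {x} * (I * (I / I / I)) * (I * (I / I / I)) := by
            rw [mul_assoc, trace_mul_self h]
        _ ≤ I / I * (I * (I / I / I)) := mul_le_mul' hxH le_rfl
        _ = I * (I / I / I) := by rw [← mul_assoc, div_self_mul_self_eq]
    have hHI : I * (I / I / I) * I = I := by rw [mul_comm, mul_trace_eq h]
    have hxI : Submodule.span R {x} * I ≤ I := by
      calc Submodule.span R {x} * I = Submodule.span R {x} * (I * (I / I / I)) * I := by
            rw [mul_assoc, hHI]
        _ ≤ I * (I / I / I) * I := mul_le_mul' hxH' le_rfl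
        _ = I := hHI
    exact Submodule.mem_one.mpr
      ⟨⟨x, Submodule.le_div_iff_mul_le.mpr hxI (Submodule.mem_span_singleton_self x)⟩, rfl⟩
  rw [hdiv N hN] at hone
  obtain ⟨n, hn, hn1⟩ := hone
  exact hN.ne_top ((Ideal.eq_top_iff_one _).mpr ((Subtype.ext hn1 : n = 1) ▸ hn))

theorem StableDomain.maximal_divisorial {R K : Type*} [CommRing R] [IsDomain R] [Field K]
    [Algebra R K] [IsFractionRing R K] {M : Ideal R} (hM : M ≠ ⊤) (hM0 : M ≠ ⊥)
    (h : StableDomain R K) {E : Subalgebra R K}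
    (hE : E = endAlg R K (idealK R K M)) (N : Ideal E) (hN : N.IsMaximal) :
    vS E K (idealK E K N) = idealK E K N := by
  have hinj := IsFractionRing.injective R K
  have hEM : ∀ e : E, ∀ m ∈ M, ∃ m' ∈ M, algebraMap R K m' = e * algebraMap R K m :=
    fun e m hm => Submodule.mem_div_iff_forall_mul_mem.mp
      (hE ▸ e.2 : (e : K) ∈ endAlg R K _) _ (algebraMap_mem_idealK hm)
  obtain ⟨m, hm, hm0⟩ := Submodule.exists_mem_ne_zero_of_ne_bot hM0
  have hN0 : N ≠ ⊥ := by
    rintro rfl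
    have hfield : IsField E := Ring.isField_iff_maximal_bot.mpr hN
    obtain ⟨e, he⟩ := hfield.mul_inv_cancel (a := algebraMap R E m) fun h0 =>
      hm0 (hinj (by simpa using congrArg (Subtype.val) h0))
    obtain ⟨m', hm', hme⟩ := hEM e m hm
    refine hM ((Ideal.eq_top_iff_one _).mpr ?_)
    have : m' = 1 := hinj (by rw [hme, map_one, mul_comm]; exact congrArg Subtype.val he)
    exact this ▸ hm'
  set N' : Submodule R K := (idealK E K N).restrictScalars R
  have hN'E : ∀ x ∈ N', x ∈ E := by
    rintro _ ⟨n, -, rfl⟩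
    exact n.2
  have hfrac : IsFrac R K N' := by
    refine ⟨fun hb => ?_, m, hm0, fun x hx => ?_⟩
    · obtain ⟨n, hn, hn0⟩ := Submodule.exists_mem_ne_zero_of_ne_bot hN0
      have : (n : K) ∈ N' := ⟨n, hn, rfl⟩
      rw [hb, Submodule.mem_bot] at this
      exact hn0 (Subtype.ext this)
    · obtain ⟨m', -, h'⟩ := hEM ⟨x, hN'E x hx⟩ m hm
      exact ⟨m', by rw [h', mul_comm]⟩
  have hone : (1 : K) ∉ idealK E K N := by
    rintro ⟨n, hn, hn1⟩
    exact hN.ne_top ((Ideal.eq_top_iff_one _).mpr ((Subtype.ext hn1 : n = 1) ▸ hn))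
  have hle : idealK E K N ≤ vS E K (idealK E K N) := by
    rw [vS, Submodule.le_div_iff_mul_le, mul_comm]
    exact Submodule.le_div_iff_mul_le.mp le_rfl
  refine (hle.antisymm fun y hy => ?_).symm
  by_contra hyN
  have h1 : (1 : Submodule E K) ≤ 1 / idealK E K N := by
    refine Submodule.one_le.mpr (Submodule.one_mem_div.mpr ?_)
    rintro _ ⟨n, -, rfl⟩
    exact Submodule.mem_one.mpr ⟨n, rfl⟩
  obtain ⟨y, rfl⟩ := Submodule.mem_one.mp (by
    have := Submodule.mem_div_iff_forall_mul_mem.mp hy 1 (h1 (Submodule.one_le.mp le_rfl))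
    rwa [mul_one] at this)
  obtain ⟨e, n, hn, hen⟩ := hN.exists_inv (x := y) fun hyn => hyN ⟨y, hyn, rfl⟩
  have hdense : 1 / idealK E K N ≤ 1 := by
    refine Submodule.one_mem_div.mp ?_
    have h3 := add_mem (Submodule.smul_mem (vS E K (idealK E K N)) e hy) (hle ⟨n, hn, rfl⟩)
    have h4 : e • algebraMap E K y + Algebra.linearMap E K n = 1 := by
      rw [Algebra.smul_def]
      exact congrArg Subtype.val hen
    rwa [h4] at h3
  have hmemE : ∀ z : K, (∀ x ∈ N', z * x ∈ E) → z ∈ E := by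
    intro z hz
    obtain ⟨e, rfl⟩ := Submodule.mem_one.mp (hdense (Submodule.mem_div_iff_forall_mul_mem.mpr
      fun x hx => Submodule.mem_one.mpr ⟨⟨_, hz x hx⟩, rfl⟩))
    exact e.2
  have hst : N' * (N' / N' / N') = N' / N' := h N' hfrac
  have h1N : (1 : K) ∈ N' * (N' / N' / N') :=
    hst.ge (Submodule.one_mem_div.mpr le_rfl)
  have hsub : N' * (N' / N' / N') ≤ N' := by
    rw [Submodule.mul_le]
    intro x hx z hz
    have hzE : z ∈ E := hmemE z fun w hw => hmemE _ fun v hv => hN'E _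
      (Submodule.mem_div_iff_forall_mul_mem.mp
        (Submodule.mem_div_iff_forall_mul_mem.mp hz w hw) v hv)
    rw [mul_comm]
    exact Submodule.smul_mem (idealK E K N) (⟨z, hzE⟩ : E) hx
  exact hone (hsub h1N)

theorem mem_mul_span_one_singleton {R K : Type*} [CommRing R] [Field K] [Algebra R K]
    {A : Submodule R K} {a x : K} :
    x ∈ A * (1 ⊔ Submodule.span R {a}) ↔ ∃ u ∈ A, ∃ v ∈ A, x = u + v * a := by
  rw [Submodule.mul_sup, mul_one, Submodule.mem_sup]
  simp only [Submodule.mem_mul_span_singleton]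
  constructor
  · rintro ⟨u, hu, _, ⟨v, hv, rfl⟩, rfl⟩
    exact ⟨u, hu, v, hv, rfl⟩
  · rintro ⟨u, hu, v, hv, rfl⟩
    exact ⟨u, hu, _, ⟨v, hv, rfl⟩, rfl⟩

theorem isFrac_one_sup_span_singleton {R K : Type*} [CommRing R] [IsDomain R] [Field K]
    [Algebra R K] [IsFractionRing R K] (a : K) : IsFrac R K (1 ⊔ Submodule.span R {a}) := by
  obtain ⟨p, q, hq, rfl⟩ := IsFractionRing.div_surjective (A := R) a
  have hq0 : algebraMap R K q ≠ 0 := IsFractionRing.to_map_ne_zero_of_mem_nonZeroDivisors hq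
  refine ⟨fun hb => ?_, q, nonZeroDivisors.ne_zero hq, fun x hx => ?_⟩
  · have : (1 : K) ∈ (1 ⊔ Submodule.span R {algebraMap R K p / algebraMap R K q}) :=
      Submodule.mem_sup_left (Submodule.one_le.mp le_rfl)
    rw [hb, Submodule.mem_bot] at this
    exact one_ne_zero this
  · obtain ⟨_, hr, _, hs, rfl⟩ := Submodule.mem_sup.mp hx
    obtain ⟨r, rfl⟩ := Submodule.mem_one.mp hr
    obtain ⟨s, rfl⟩ := Submodule.mem_span_singleton.mp hs
    refine ⟨q * r + s * p, ?_⟩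
    rw [Algebra.smul_def, map_add, map_mul, map_mul]
    field_simp

/-- In a Clifford regular domain every fractional ideal `J = (1, a)` is stable; in terms of
elements of a suitable `X` with `J²X = J`. -/
theorem CliffordRegularDomain.exists_add_mul_eq_one {R K : Type*} [CommRing R] [IsDomain R]
    [Field K] [Algebra R K] [IsFractionRing R K] (h : CliffordRegularDomain R K) (a : K) :
    ∃ u v : K, 1 = u + v * a ∧ v ∈ (1 ⊔ Submodule.span R {a} : Submodule R K) ∧
      u * (a * a) ∈ (1 ⊔ Submodule.span R {a} : Submodule R K) := by
  obtain ⟨X, -, hX⟩ := h _ (isFrac_one_sup_span_singleton (R := R) a)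
  set J : Submodule R K := 1 ⊔ Submodule.span R {a}
  have h1J : (1 : K) ∈ J := Submodule.mem_sup_left (Submodule.one_le.mp le_rfl)
  have haJ : a ∈ J := Submodule.mem_sup_right (Submodule.mem_span_singleton_self a)
  have hJ : J = X * J * J := by rw [mul_assoc, mul_comm, ← hX]
  have hidem : X * J * (X * J) = X * J := by
    calc X * J * (X * J) = X * (X * J * J) := by ring
      _ = X * J := by rw [← hJ]
  have h1 : (1 : K) ∈ X * J := by
    obtain ⟨p, hp, q, hq, hpq⟩ := mem_mul_span_one_singleton.mp (hJ ▸ h1J : (1 : K) ∈ X * J * J)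
    obtain ⟨r, hr, s, hs, hrs⟩ := mem_mul_span_one_singleton.mp (hJ ▸ haJ : a ∈ X * J * J)
    have hdet : (1 : K) = p + s - p * s + q * r := by
      linear_combination (1 - s) * hpq + q * hrs
    rw [hdet]
    refine add_mem (sub_mem (add_mem hp hs) ?_) ?_ <;> rw [← hidem]
    · exact Submodule.mul_mem_mul hp hs
    · exact Submodule.mul_mem_mul hq hr
  obtain ⟨u, hu, v, hv, huv⟩ := mem_mul_span_one_singleton.mp h1
  have hmem : ∀ x ∈ X, ∀ y ∈ J, ∀ z ∈ J, x * (y * z) ∈ J := by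
    intro x hx y hy z hz
    rw [hX, mul_comm (J * J)]
    exact Submodule.mul_mem_mul hx (Submodule.mul_mem_mul hy hz)
  exact ⟨u, v, huv, by simpa using hmem v hv 1 h1J 1 h1J, hmem u hu a haJ a haJ⟩

/-- A valuation subring containing the image of `R`, as an `R`-subalgebra. -/
def ValuationSubring.toSubalgebraOfForallMem {R K : Type*} [CommRing R] [Field K] [Algebra R K]
    (V : ValuationSubring K) (hV : ∀ r : R, algebraMap R K r ∈ V) : Subalgebra R K :=
  { V.toSubring with algebraMap_mem' := hV }

theorem ValuationSubring.inv_mem_of_notMem_nonunits {K : Type*} [Field K]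
    {V : ValuationSubring K} {x : K} (hx : x ∉ V.nonunits) : x⁻¹ ∈ V := by
  by_contra h
  exact hx (V.mem_nonunits_iff_or.mpr (Or.inr h))

theorem ValuationSubring.mul_mem_nonunits {K : Type*} [Field K]
    {V : ValuationSubring K} {x y : K} (hx : x ∈ V.nonunits) (hy : y ∈ V) :
    x * y ∈ V.nonunits := by
  rw [V.mem_nonunits_iff, map_mul]
  exact mul_lt_one_of_lt_of_le hx ((V.valuation_le_one_iff y).mpr hy)

theorem ValuationSubring.one_notMem_nonunits {K : Type*} [Field K]
    {V : ValuationSubring K} : (1 : K) ∉ V.nonunits := by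
  simp [V.mem_nonunits_iff]

theorem CliffordRegularDomain.mul_self_mem {R K : Type*} [CommRing R] [IsDomain R]
    [Field K] [Algebra R K] [IsFractionRing R K] (h : CliffordRegularDomain R K) {M : Ideal R}
    {V : ValuationSubring K} (hV : ∀ r : R, algebraMap R K r ∈ V)
    (hM : ∀ r : R, algebraMap R K r ∈ V.nonunits ↔ r ∈ M) {a : K} (ha : a ∈ V.nonunits) :
    a * a ∈ idealK R K M * (V.toSubalgebraOfForallMem hV).toSubmodule := by
  obtain ⟨u, v, huv, hv, hu⟩ := h.exists_add_mul_eq_one a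
  have haV : a ∈ V := ValuationSubring.nonunits_subset ha
  have hvV : v ∈ V := by
    obtain ⟨_, hr, _, hs, rfl⟩ := Submodule.mem_sup.mp hv
    obtain ⟨r, rfl⟩ := Submodule.mem_one.mp hr
    obtain ⟨s, rfl⟩ := Submodule.mem_span_singleton.mp hs
    rw [Algebra.smul_def]
    exact add_mem (hV r) (mul_mem (hV s) haV)
  have hu1 : u = 1 - a * v := by linear_combination -huv
  have huV : u ∈ V := hu1 ▸ sub_mem (one_mem V) (mul_mem haV hvV)
  have hunit : u ∉ V.nonunits := fun hn => ValuationSubring.one_notMem_nonunits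
    (huv ▸ add_mem hn (mul_comm a v ▸ ValuationSubring.mul_mem_nonunits ha hvV))
  have hu0 : u ≠ 0 := fun h0 => hunit (h0 ▸ zero_mem V.nonunits)
  have huinv := ValuationSubring.inv_mem_of_notMem_nonunits hunit
  obtain ⟨_, hr, _, hs, hfe⟩ := Submodule.mem_sup.mp hu
  obtain ⟨f, rfl⟩ := Submodule.mem_one.mp hr
  obtain ⟨e, rfl⟩ := Submodule.mem_span_singleton.mp hs
  rw [Algebra.smul_def] at hfe
  have hauV : a * u ∈ V.nonunits := ValuationSubring.mul_mem_nonunits ha huV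
  have hf : f ∈ M := by
    rw [← hM, show algebraMap R K f = a * (u * a - algebraMap R K e) by linear_combination hfe]
    exact ValuationSubring.mul_mem_nonunits ha (sub_mem (mul_mem huV haV) (hV e))
  have hprod : ∀ m ∈ M, ∀ w ∈ V, algebraMap R K m * w ∈
      idealK R K M * (V.toSubalgebraOfForallMem hV).toSubmodule :=
    fun m hm w hw => Submodule.mul_mem_mul (algebraMap_mem_idealK hm) hw
  by_cases he : e ∈ M
  · have : a * a = algebraMap R K f * u⁻¹ + algebraMap R K e * (a * u⁻¹) := by
      field_simp
      linear_combination -hfe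
    rw [this]
    exact add_mem (hprod f hf _ huinv) (hprod e he _ (mul_mem haV huinv))
  · have hd : a * u - algebraMap R K e ∉ V.nonunits := fun hn => he ((hM e).mp (by
      have := sub_mem hauV hn
      rwa [sub_sub_cancel] at this))
    have hd0 : a * u - algebraMap R K e ≠ 0 := fun h0 => hd (h0 ▸ zero_mem V.nonunits)
    have : a * a = algebraMap R K f * ((a * u - algebraMap R K e)⁻¹ * a) := by
      rw [← mul_assoc, ← div_eq_mul_inv, eq_comm, div_mul_eq_mul_div, div_eq_iff hd0]
      linear_combination a * hfe
    rw [this]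
    exact hprod f hf _ (mul_mem (ValuationSubring.inv_mem_of_notMem_nonunits hd) haV)

theorem CliffordRegularDomain.mul_mem {R K : Type*} [CommRing R] [IsDomain R]
    [Field K] [Algebra R K] [IsFractionRing R K] (h : CliffordRegularDomain R K) {M : Ideal R}
    {V : ValuationSubring K} (hV : ∀ r : R, algebraMap R K r ∈ V)
    (hM : ∀ r : R, algebraMap R K r ∈ V.nonunits ↔ r ∈ M) {a b : K} (ha : a ∈ V.nonunits)
    (hb : b ∈ V.nonunits) :
    a * b ∈ idealK R K M * (V.toSubalgebraOfForallMem hV).toSubmodule := by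
  have key : ∀ a b : K, b ∈ V.nonunits → a * b⁻¹ ∈ V →
      a * b ∈ idealK R K M * (V.toSubalgebraOfForallMem hV).toSubmodule := by
    intro a b hb hab
    rcases eq_or_ne b 0 with rfl | hb0
    · simp
    have := Submodule.mul_mem_mul (h.mul_self_mem hV hM hb)
      (show a * b⁻¹ ∈ (V.toSubalgebraOfForallMem hV).toSubmodule from hab)
    rw [mul_assoc (idealK R K M), (Subalgebra.isIdempotentElem_toSubmodule _).eq] at this
    convert this using 1
    field_simp
  rcases V.mem_or_inv_mem (a * b⁻¹) with hab | hab
  · exact key a b hb hab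
  · rw [mul_comm a b]
    exact key b a ha (by rwa [mul_inv, inv_inv, mul_comm] at hab)

theorem exists_fg_of_mem_idealK_mul {R K : Type*} [CommRing R] [Field K] [Algebra R K]
    {M : Ideal R} {Q : Submodule R K} {x : K} (hx : x ∈ idealK R K M * Q) :
    ∃ F : Ideal R, F.FG ∧ F ≤ M ∧ x ∈ idealK R K F * Q := by
  induction hx using Submodule.mul_induction_on' with
  | mem_mul_mem m hm n hn =>
    obtain ⟨r, hr, rfl⟩ := hm
    exact ⟨Ideal.span {r}, ⟨{r}, by simp⟩, (Ideal.span_singleton_le_iff_mem _).mpr hr,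
      Submodule.mul_mem_mul (algebraMap_mem_idealK (Ideal.mem_span_singleton_self r)) hn⟩
  | add x hx y hy ihx ihy =>
    obtain ⟨F, hF, hFM, hxF⟩ := ihx
    obtain ⟨G, hG, hGM, hyG⟩ := ihy
    refine ⟨F ⊔ G, Submodule.FG.sup hF hG, sup_le hFM hGM, add_mem ?_ ?_⟩
    · exact mul_le_mul' (Submodule.map_mono le_sup_left) le_rfl hxF
    · exact mul_le_mul' (Submodule.map_mono le_sup_right) le_rfl hyG

theorem mem_of_not_isUnit_of_forall_prime {R : Type*} [CommRing R] {M : Ideal R}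
    (hdim : ∀ P : Ideal R, P.IsPrime → P ≠ ⊥ → P = M) {x : R} (hx : ¬ IsUnit x) : x ∈ M := by
  obtain ⟨P, hP, hxP⟩ := exists_max_ideal_of_mem_nonunits hx
  by_cases h0 : P = ⊥
  · rw [h0, Ideal.mem_bot] at hxP
    exact hxP ▸ zero_mem M
  · exact hdim P hP.isPrime h0 ▸ hxP

theorem le_radical_of_forall_prime {R : Type*} [CommRing R] {M : Ideal R}
    (hdim : ∀ P : Ideal R, P.IsPrime → P ≠ ⊥ → P = M) {A : Ideal R} (hA : A ≠ ⊥) :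
    M ≤ A.radical := by
  rw [Ideal.radical_eq_sInf]
  refine le_sInf fun P ⟨hAP, hP⟩ => (hdim P hP ?_).ge
  rintro rfl
  exact hA (le_bot_iff.mp hAP)

theorem comap_ne_bot_of_ne_bot {R K : Type*} [CommRing R] [IsDomain R] [Field K] [Algebra R K]
    [IsFractionRing R K] {H : Submodule R K} (hH : H ≠ ⊥) :
    H.comap (Algebra.linearMap R K) ≠ ⊥ := by
  obtain ⟨x, hx, hx0⟩ := Submodule.exists_mem_ne_zero_of_ne_bot hH
  obtain ⟨p, q, hq, rfl⟩ := IsFractionRing.div_surjective (A := R) x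
  have hq0 : algebraMap R K q ≠ 0 := IsFractionRing.to_map_ne_zero_of_mem_nonZeroDivisors hq
  intro hb
  have hp : p ∈ H.comap (Algebra.linearMap R K) := by
    have := H.smul_mem q hx
    rwa [Algebra.smul_def, mul_div_cancel₀ _ hq0] at this
  rw [hb, Submodule.mem_bot] at hp
  exact hx0 (by simp [hp])

theorem CliffordRegularDomain.stableDomain {R K : Type*} [CommRing R] [IsDomain R] [Field K]
    [Algebra R K] [IsFractionRing R K] {M : Ideal R}
    (hdim : ∀ P : Ideal R, P.IsPrime → P ≠ ⊥ → P = M)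
    (h : CliffordRegularDomain R K) (hst : IsStableIdeal R K (idealK R K M)) :
    StableDomain R K := by
  intro I hI
  by_contra hI'
  obtain ⟨X, -, hX⟩ := h I hI
  have h1H : (1 : K) ∉ I * (I / I / I) := fun h1 => hI' (isStableIdeal_of_one_mem h1)
  obtain ⟨V, hTV, hHV⟩ := Ideal.image_subset_nonunits_valuationSubring
    (A := (endAlg R K I).toSubring) (traceIdeal I) (traceIdeal_ne_top h1H)
  have hHT := trace_le I
  have hHI := mul_trace_eq hX
  have hHH := trace_mul_self hX
  have hHV' : ∀ x ∈ I * (I / I / I), x ∈ V.nonunits :=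
    fun x hx => hHV ⟨⟨x, hHT hx⟩, mem_traceIdeal.mpr hx, rfl⟩
  set H := I * (I / I / I)
  have hH0 : H ≠ ⊥ := fun h0 => hI.1 (by rw [← hHI, h0, Submodule.mul_bot])
  have hV : ∀ r : R, algebraMap R K r ∈ V := fun r => hTV ((endAlg R K I).algebraMap_mem r)
  have hrad := le_radical_of_forall_prime hdim (comap_ne_bot_of_ne_bot hH0)
  have hMV : ∀ r : R, algebraMap R K r ∈ V.nonunits ↔ r ∈ M := by
    refine fun r => ⟨fun hr => mem_of_not_isUnit_of_forall_prime hdim fun hu => ?_, fun hr => ?_⟩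
    · obtain ⟨s, hs⟩ := hu.exists_right_inv
      refine ValuationSubring.one_notMem_nonunits (V := V) ?_
      rw [← map_one (algebraMap R K), ← hs, map_mul]
      exact ValuationSubring.mul_mem_nonunits hr (hV s)
    · obtain ⟨n, hn⟩ := hrad hr
      have hn' : algebraMap R K (r ^ n) ∈ V.nonunits := hHV' _ hn
      rw [V.mem_nonunits_iff, map_pow, map_pow] at hn'
      exact V.mem_nonunits_iff.mpr (lt_of_not_ge fun hge => hn'.not_ge (one_le_pow₀ hge))
  set W := (V.toSubalgebraOfForallMem hV).toSubmodule
  have hWW : W * W = W := Subalgebra.isIdempotentElem_toSubmodule _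
  have hMW : ∀ x ∈ idealK R K M * W, x ∈ V.nonunits := by
    intro x hx
    induction hx using Submodule.mul_induction_on' with
    | mem_mul_mem m hm w hw =>
      obtain ⟨r, hr, rfl⟩ := hm
      exact ValuationSubring.mul_mem_nonunits ((hMV r).mpr hr) hw
    | add x _ y _ ihx ihy => exact add_mem ihx ihy
  have hHMW : H ≤ idealK R K M * W := by
    rw [← hHH, Submodule.mul_le]
    exact fun a ha b hb => h.mul_mem hV hMV (hHV' a ha) (hHV' b hb)
  set E := idealK R K M / idealK R K M
  set Q := E / idealK R K M
  have hMQ : idealK R K M * Q = E := hst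
  have h1E : (1 : K) ∈ E := Submodule.one_mem_div.mpr le_rfl
  obtain ⟨F, hF, hFM, h1F⟩ := exists_fg_of_mem_idealK_mul (hMQ ▸ h1E : (1 : K) ∈ _ * Q)
  obtain ⟨k, hk⟩ := Ideal.exists_pow_le_of_le_radical_of_fg (hFM.trans hrad) hF
  have hFH : idealK R K F ^ k ≤ H := by
    rw [← idealK_pow]
    exact Submodule.map_le_iff_le_comap.mpr hk
  have hHpow : ∀ n : ℕ, H ^ (n + 1) = H := by
    intro n
    induction n with
    | zero => simp
    | succ n ih => rw [pow_succ, ih, hHH]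
  have hWpow : ∀ n : ℕ, W ^ (n + 1) = W := by
    intro n
    induction n with
    | zero => simp
    | succ n ih => rw [pow_succ, ih, hWW]
  have hEpow : ∀ n : ℕ, E ^ n * idealK R K M = idealK R K M := by
    intro n
    induction n with
    | zero => simp
    | succ n ih => rw [pow_succ, mul_assoc, div_self_mul_self_eq, ih]
  have hle : (idealK R K F * Q) ^ k ≤ idealK R K M * W := by
    calc (idealK R K F * Q) ^ k = idealK R K F ^ k * Q ^ k := mul_pow _ _ _
      _ ≤ H * Q ^ k := mul_le_mul' hFH le_rfl
      _ = H ^ (k + 1) * Q ^ k := by rw [hHpow]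
      _ ≤ (idealK R K M * W) ^ (k + 1) * Q ^ k :=
        mul_le_mul' (pow_le_pow_left' hHMW _) le_rfl
      _ = (idealK R K M * Q) ^ k * idealK R K M * W ^ (k + 1) := by ring
      _ = idealK R K M * W := by rw [hMQ, hEpow, hWpow]
  refine ValuationSubring.one_notMem_nonunits (hMW 1 (hle ?_))
  simpa using Submodule.pow_mem_pow _ h1F k

/-- Let `(R, M)` be a local one-dimensional domain and `E := (M : M)`.
The following are equivalent: (i) `R` is stable; (ii) `R` is Clifford regular and `M` is a
stable ideal of `R`; (iii) `R` is Clifford regular and every maximal ideal of `E` is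
divisorial in `E`. -/
theorem local_one_dim_stable_iff
    {R K : Type*} [CommRing R] [IsDomain R] [Field K] [Algebra R K] [IsFractionRing R K]
    (M : Ideal R) (hM : M.IsMaximal) (hM0 : M ≠ ⊥)
    (hdim : ∀ P : Ideal R, P.IsPrime → P ≠ ⊥ → P = M) :
    (StableDomain R K ↔ (CliffordRegularDomain R K ∧ IsStableIdeal R K (idealK R K M))) ∧
      (StableDomain R K ↔
        (CliffordRegularDomain R K ∧
          ∀ N : Ideal (endAlg R K (idealK R K M)), N.IsMaximal →
            vS (endAlg R K (idealK R K M)) K (idealK (endAlg R K (idealK R K M)) K N) =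
              idealK (endAlg R K (idealK R K M)) K N)) := by
  have hstM (h : StableDomain R K) : IsStableIdeal R K (idealK R K M) := h _ (isFrac_idealK hM0)
  refine ⟨⟨fun h => ⟨h.cliffordRegularDomain, hstM h⟩,
    fun h => h.1.stableDomain hdim h.2⟩,
    fun h => ⟨h.cliffordRegularDomain, h.maximal_divisorial hM.ne_top hM0 rfl⟩, fun ⟨h, hdiv⟩ => ?_⟩
  obtain ⟨X, -, hX⟩ := h _ (isFrac_idealK hM0)
  exact h.stableDomain hdim (isStableIdeal_of_forall_maximal_divisorial hX hdiv)
end
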